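/- arXiv:1105.5490 — 2 statements merged into one kernel-verified Lean document; each statement's English description precedes it below -/
import Mathlib

section
/- For each integer k ≥ 1, let σ̂_k be the supremum of λmin(G) over all connected finite simple graphs G with minimum degree at least k and λmin(G) < −1−√2. Then the sequence (σ̂_k) is nonincreasing in k and its limit as k → ∞ equals α₁, the smallest real root of the polynomial x³ + 2x² − 2x − 2. -/
open SimpleGraph Filter

attribute [local instance] Classical.propDecidable

lemma adjMatrix_isHermitian {V : Type} [Fintype V] [DecidableEq V] (G : SimpleGraph V)
    [DecidableRel G.Adj] : (G.adjMatrix ℝ).IsHermitian := by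
  rw [Matrix.IsHermitian, Matrix.conjTranspose_eq_transpose_of_trivial]
  exact G.isSymm_adjMatrix

/-- The smallest eigenvalue of the (real) adjacency matrix of a finite simple graph. -/
noncomputable def lambdaMin {V : Type} [Fintype V] (G : SimpleGraph V) : ℝ :=
  ⨅ i : V, (adjMatrix_isHermitian G).eigenvalues i

open Matrix Finset

lemma mul_dotProduct_self_le_of_forall_eigenvalue_ge {V : Type} [Fintype V] {M : Matrix V V ℝ}
    (hM : M.IsHermitian) {c : ℝ}
    (h : ∀ (μ : ℝ) (x : V → ℝ), x ≠ 0 → M *ᵥ x = μ • x → c ≤ μ) (x : V → ℝ) :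
    c * (x ⬝ᵥ x) ≤ x ⬝ᵥ M *ᵥ x := by
  have hN : (M - c • (1 : Matrix V V ℝ)).IsHermitian := by
    rw [Matrix.IsHermitian, conjTranspose_sub, hM.eq, conjTranspose_smul, conjTranspose_one]
    simp
  have hpsd : (M - c • (1 : Matrix V V ℝ)).PosSemidef := by
    rw [hN.posSemidef_iff_eigenvalues_nonneg]
    intro i
    have h1 := hN.mulVec_eigenvectorBasis i
    have h2 : (hN.eigenvectorBasis i).ofLp ≠ 0 := fun h0 ↦
      hN.eigenvectorBasis.orthonormal.ne_zero i (by ext j; exact congrFun h0 j)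
    have h3 := h (hN.eigenvalues i + c) _ h2 (by
      rw [sub_mulVec, smul_mulVec, one_mulVec, sub_eq_iff_eq_add] at h1
      rw [h1, add_smul])
    simpa using h3
  have h4 := hpsd.dotProduct_mulVec_nonneg x
  simp only [star_trivial, sub_mulVec, smul_mulVec, one_mulVec, dotProduct_sub,
    dotProduct_smul, smul_eq_mul] at h4
  linarith

lemma lambdaMin_mul_dotProduct_self_le {V : Type} [Fintype V] (G : SimpleGraph V) (x : V → ℝ) :
    lambdaMin G * (x ⬝ᵥ x) ≤ x ⬝ᵥ G.adjMatrix ℝ *ᵥ x := by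
  refine mul_dotProduct_self_le_of_forall_eigenvalue_ge (adjMatrix_isHermitian G) ?_ x
  intro μ y hy hμ
  have h1 : μ ∈ spectrum ℝ (G.adjMatrix ℝ) := by
    rw [← Matrix.spectrum_toLin', ← Module.End.hasEigenvalue_iff_mem_spectrum]
    exact Module.End.hasEigenvalue_of_hasEigenvector
      ⟨Module.End.mem_eigenspace_iff.mpr (by simpa using hμ), hy⟩
  rw [(adjMatrix_isHermitian G).spectrum_real_eq_range_eigenvalues] at h1
  obtain ⟨i, rfl⟩ := h1
  exact ciInf_le (Set.finite_range _).bddBelow i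

lemma le_lambdaMin {V : Type} [Fintype V] [Nonempty V] (G : SimpleGraph V) {c : ℝ}
    (h : ∀ x : V → ℝ, c * (x ⬝ᵥ x) ≤ x ⬝ᵥ G.adjMatrix ℝ *ᵥ x) : c ≤ lambdaMin G := by
  refine le_ciInf fun i ↦ ?_
  set b := ((adjMatrix_isHermitian G).eigenvectorBasis i).ofLp with hb
  have h1 := (adjMatrix_isHermitian G).mulVec_eigenvectorBasis i
  have h2 : b ≠ 0 := fun h0 ↦
    (adjMatrix_isHermitian G).eigenvectorBasis.orthonormal.ne_zero i (by ext j; exact congrFun h0 j)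
  have h3 : 0 < b ⬝ᵥ b := by simpa using Matrix.dotProduct_star_self_pos_iff.mpr h2
  have h4 := h b
  rw [h1, dotProduct_smul, smul_eq_mul] at h4
  exact le_of_mul_le_mul_right h4 h3

lemma dotProduct_adjMatrix_mulVec {V : Type} [Fintype V] (G : SimpleGraph V) (x y : V → ℝ) :
    x ⬝ᵥ G.adjMatrix ℝ *ᵥ y = ∑ u, ∑ v, if G.Adj u v then x u * y v else 0 := by
  simp only [dotProduct, mulVec, Finset.mul_sum, SimpleGraph.adjMatrix_apply]
  refine Finset.sum_congr rfl fun u _ ↦ Finset.sum_congr rfl fun v _ ↦ ?_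
  split_ifs <;> simp

lemma lambdaMin_le_of_iso {V W : Type} [Fintype V] [Fintype W] [Nonempty W] {G : SimpleGraph V}
    {H : SimpleGraph W} (e : G ≃g H) : lambdaMin G ≤ lambdaMin H := by
  refine le_lambdaMin H fun x ↦ ?_
  have h := lambdaMin_mul_dotProduct_self_le G (x ∘ e)
  have h1 : (x ∘ e) ⬝ᵥ (x ∘ e) = x ⬝ᵥ x := Equiv.sum_comp e.toEquiv fun w ↦ x w * x w
  have h2 : (x ∘ e) ⬝ᵥ G.adjMatrix ℝ *ᵥ (x ∘ e) = x ⬝ᵥ H.adjMatrix ℝ *ᵥ x := by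
    rw [dotProduct_adjMatrix_mulVec, dotProduct_adjMatrix_mulVec]
    rw [← Equiv.sum_comp e.toEquiv]
    refine Finset.sum_congr rfl fun u _ ↦ ?_
    rw [← Equiv.sum_comp e.toEquiv]
    refine Finset.sum_congr rfl fun v _ ↦ ?_
    exact if_congr e.map_adj_iff.symm rfl rfl
  rwa [h1, h2] at h

lemma lambdaMin_eq_of_iso {V W : Type} [Fintype V] [Fintype W] [Nonempty V] {G : SimpleGraph V}
    {H : SimpleGraph W} (e : G ≃g H) : lambdaMin G = lambdaMin H :=
  have : Nonempty W := ⟨e (Classical.arbitrary V)⟩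
  le_antisymm (lambdaMin_le_of_iso e) (lambdaMin_le_of_iso e.symm)

/-- Every principal submatrix of `S` of order at most four is at least `c`, as a quadratic form. -/
def SmallMinorsGE {V : Type} (S : Matrix V V ℝ) (c : ℝ) : Prop :=
  ∀ (r : ℕ) (g : Fin r → V) (t : Fin r → ℝ), r ≤ 4 → Function.Injective g →
    c * ∑ i, t i ^ 2 ≤ ∑ i, ∑ j, t i * t j * S (g i) (g j)

lemma cubic_root_bounds {α : ℝ}
    (hα : IsLeast {x : ℝ | x ^ 3 + 2 * x ^ 2 - 2 * x - 2 = 0} α) :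
    -5 / 2 < α ∧ α ≤ -49 / 20 := by
  constructor
  · by_contra! h
    have h1 : α ^ 3 + 2 * α ^ 2 - 2 * α - 2 = 0 := hα.1
    nlinarith [mul_nonneg (sub_nonneg.mpr h) (sub_nonneg.mpr h),
      mul_nonneg (mul_nonneg (sub_nonneg.mpr h) (sub_nonneg.mpr h)) (sub_nonneg.mpr h)]
  · have hc : ContinuousOn (fun x : ℝ ↦ x ^ 3 + 2 * x ^ 2 - 2 * x - 2)
        (Set.Icc (-5 / 2) (-49 / 20)) := by fun_prop
    obtain ⟨x, hx, hx0⟩ := intermediate_value_Icc (by norm_num) hc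
      (show (0 : ℝ) ∈ Set.Icc _ _ by constructor <;> norm_num)
    exact (hα.2 hx0).trans hx.2

namespace SmallMinorsGE

variable {V : Type} {S : Matrix V V ℝ} {c : ℝ}

lemma one (h : SmallMinorsGE S c) (a : V) : c ≤ S a a := by
  have := h 1 ![a] ![1] (by norm_num) (Function.injective_of_subsingleton _)
  simpa using this

lemma two (h : SmallMinorsGE S c) (hS : S.IsSymm) {a b : V} (hab : a ≠ b) (x y : ℝ) :
    c * (x ^ 2 + y ^ 2) ≤ x ^ 2 * S a a + y ^ 2 * S b b + 2 * (x * y * S a b) := by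
  have := h 2 ![a, b] ![x, y] (by norm_num) (by
    intro i j; fin_cases i <;> fin_cases j <;> simp [hab, hab.symm])
  simp [Fin.sum_univ_two] at this
  rw [hS.apply a b] at this
  linarith

lemma three (h : SmallMinorsGE S c) (hS : S.IsSymm) {a b d : V} (hab : a ≠ b) (had : a ≠ d)
    (hbd : b ≠ d) (x y z : ℝ) :
    c * (x ^ 2 + y ^ 2 + z ^ 2) ≤ x ^ 2 * S a a + y ^ 2 * S b b + z ^ 2 * S d d +
      2 * (x * y * S a b + x * z * S a d + y * z * S b d) := by
  have := h 3 ![a, b, d] ![x, y, z] (by norm_num) (by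
    intro i j; fin_cases i <;> fin_cases j <;> simp [*, hab.symm, had.symm, hbd.symm])
  simp [Fin.sum_univ_three] at this
  rw [hS.apply a b, hS.apply a d, hS.apply b d] at this
  linarith

lemma four (h : SmallMinorsGE S c) (hS : S.IsSymm) {a b d e : V} (hab : a ≠ b) (had : a ≠ d)
    (hae : a ≠ e) (hbd : b ≠ d) (hbe : b ≠ e) (hde : d ≠ e) (x y z w : ℝ) :
    c * (x ^ 2 + y ^ 2 + z ^ 2 + w ^ 2) ≤
      x ^ 2 * S a a + y ^ 2 * S b b + z ^ 2 * S d d + w ^ 2 * S e e +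
      2 * (x * y * S a b + x * z * S a d + x * w * S a e + y * z * S b d + y * w * S b e +
        z * w * S d e) := by
  have := h 4 ![a, b, d, e] ![x, y, z, w] (by norm_num) (by
    intro i j; fin_cases i <;> fin_cases j <;>
      simp [*, hab.symm, had.symm, hae.symm, hbd.symm, hbe.symm, hde.symm])
  simp [Fin.sum_univ_four] at this
  rw [hS.apply a b, hS.apply a d, hS.apply a e, hS.apply b d, hS.apply b e, hS.apply d e] at this
  linarith

/-- Off-diagonal entries of an integral matrix with small diagonal lie in `{-1, 0, 1}`. -/
lemma entry (h : SmallMinorsGE S c) (hS : S.IsSymm) (hc : -5 / 2 < c)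
    (hSZ : ∀ u v, ∃ z : ℤ, S u v = z) (hdiag : ∀ v, S v v ≤ -1) {a b : V} (hab : a ≠ b) :
    S a b = 0 ∨ S a b = 1 ∨ S a b = -1 := by
  have h1 := h.two hS hab 1 1
  have h2 := h.two hS hab 1 (-1)
  have ha := hdiag a
  have hb := hdiag b
  obtain ⟨z, hz⟩ := hSZ a b
  rw [hz] at h1 h2 ⊢
  have h3 : (-2 : ℝ) < z := by linarith
  have h4 : (z : ℝ) < 2 := by linarith
  have h5 : -2 < z := by exact_mod_cast h3
  have h6 : z < 2 := by exact_mod_cast h4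
  interval_cases z <;> simp

lemma diag_eq (h : SmallMinorsGE S c) (hS : S.IsSymm) (hc : -5 / 2 < c)
    (hSZ : ∀ u v, ∃ z : ℤ, S u v = z) (hdiag : ∀ v, S v v ≤ -1) {a b : V} (hab : a ≠ b)
    (h0 : S a b ≠ 0) : S a a = -1 := by
  by_contra hne
  obtain ⟨z, hz⟩ := hSZ a a
  have ha := hdiag a
  have hb := hdiag b
  have h2 : S a a ≤ -2 := by
    rw [hz] at ha hne ⊢
    have h3 : z ≤ -1 := by exact_mod_cast ha
    have h4 : z ≠ -1 := by rintro rfl; simp at hne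
    have h5 : z ≤ -2 := by omega
    exact_mod_cast h5
  have h3 := h.two hS hab 3 2
  have h4 := h.two hS hab 3 (-2)
  rcases h.entry hS hc hSZ hdiag hab with h5 | h5 | h5
  · exact h0 h5
  all_goals rw [h5] at h3 h4; linarith

/-- Triangles are balanced. -/
lemma triangle (h : SmallMinorsGE S c) (hS : S.IsSymm) (hc : -5 / 2 < c)
    (hSZ : ∀ u v, ∃ z : ℤ, S u v = z) (hdiag : ∀ v, S v v ≤ -1) {a b d : V} (hab : a ≠ b)
    (had : a ≠ d) (hbd : b ≠ d) (h1 : S a b ≠ 0) (h2 : S a d ≠ 0) (h3 : S b d ≠ 0) :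
    S b d = S a b * S a d := by
  have h4 := h.three hS hab had hbd 1 (-S a b) (-S a d)
  have ha := hdiag a
  have hb := hdiag b
  have hd := hdiag d
  rcases h.entry hS hc hSZ hdiag hab with h5 | h5 | h5 <;>
  rcases h.entry hS hc hSZ hdiag had with h6 | h6 | h6 <;>
  rcases h.entry hS hc hSZ hdiag hbd with h7 | h7 | h7 <;>
  first
    | exact absurd h5 h1
    | exact absurd h6 h2
    | exact absurd h7 h3
    | (rw [h5, h6, h7]; norm_num; done)
    | (exfalso; rw [h5, h6, h7] at h4; linarith)

/-- A vertex with two nonadjacent neighbours has no further neighbour: claws, paws and diamonds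
are excluded. -/
lemma eq_zero_of_path (h : SmallMinorsGE S c) (hS : S.IsSymm) {α : ℝ}
    (hα : IsLeast {x : ℝ | x ^ 3 + 2 * x ^ 2 - 2 * x - 2 = 0} α) (hc : α < c)
    (hSZ : ∀ u v, ∃ z : ℤ, S u v = z) (hdiag : ∀ v, S v v ≤ -1) {a b d e : V} (hba : b ≠ a)
    (hbd : b ≠ d) (hbe : b ≠ e) (had : a ≠ d) (hae : a ≠ e) (hde : d ≠ e) (h1 : S b a ≠ 0)
    (h2 : S b d ≠ 0) (h3 : S a d = 0) : S b e = 0 := by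
  by_contra h4
  have hα1 : α ^ 3 + 2 * α ^ 2 - 2 * α - 2 = 0 := hα.1
  have hα2 := (cubic_root_bounds hα).1
  have hα3 := (cubic_root_bounds hα).2
  have hc' : -5 / 2 < c := by linarith
  have ha := hdiag a
  have hb := hdiag b
  have hd := hdiag d
  have he := hdiag e
  have hsq : ∀ {v}, b ≠ v → S b v ≠ 0 → S b v ^ 2 = 1 := by
    intro v hv h0
    rcases h.entry hS hc' hSZ hdiag hv with h5 | h5 | h5
    · exact absurd h5 h0
    all_goals rw [h5]; norm_num
  have sa := hsq hba h1
  have sd := hsq hbd h2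
  have se := hsq hbe h4
  -- weights `p` on the hub and `-S b v * p_v` on its neighbours
  have key : ∀ p x y z : ℝ, c * (p ^ 2 + x ^ 2 + y ^ 2 + z ^ 2) ≤
      -(p ^ 2 + x ^ 2 + y ^ 2 + z ^ 2) + 2 * (-p * x - p * y - p * z +
        x * z * (S b a * S b e * S a e) + y * z * (S b d * S b e * S d e)) := by
    intro p x y z
    have h5 := h.four hS hba hbd hbe had hae hde p (-S b a * x) (-S b d * y) (-S b e * z)
    rw [h3] at h5
    have e1 : (-S b a * x) ^ 2 = x ^ 2 := by linear_combination x ^ 2 * sa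
    have e2 : (-S b d * y) ^ 2 = y ^ 2 := by linear_combination y ^ 2 * sd
    have e3 : (-S b e * z) ^ 2 = z ^ 2 := by linear_combination z ^ 2 * se
    rw [e1, e2, e3] at h5
    have e4 : p * (-S b a * x) * S b a = - p * x := by linear_combination - p * x * sa
    have e5 : p * (-S b d * y) * S b d = - p * y := by linear_combination - p * y * sd
    have e6 : p * (-S b e * z) * S b e = - p * z := by linear_combination - p * z * se
    rw [e4, e5, e6] at h5
    nlinarith [mul_nonneg (sq_nonneg p) (sub_nonneg.mpr hb),
      mul_nonneg (sq_nonneg x) (sub_nonneg.mpr ha), mul_nonneg (sq_nonneg y) (sub_nonneg.mpr hd),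
      mul_nonneg (sq_nonneg z) (sub_nonneg.mpr he)]
  have tri : ∀ {v}, b ≠ v → v ≠ e → S b v ≠ 0 →
      S b v * S b e * S v e = 0 ∨ S b v * S b e * S v e = 1 := by
    intro v hv hve h0
    by_cases h5 : S v e = 0
    · left; rw [h5, mul_zero]
    · right
      rw [h.triangle hS hc' hSZ hdiag hv hbe hve h0 h4 h5]
      linear_combination S b e ^ 2 * hsq hv h0 + se
  have hpos : 0 < ((α + 1) * α) ^ 2 + (α + 1) ^ 2 + (α + 1) ^ 2 + α ^ 2 := by
    have : 0 < α ^ 2 := by nlinarith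
    positivity
  have hlt := mul_lt_mul_of_pos_right hc hpos
  rcases tri hba hae h1 with h5 | h5 <;> rcases tri hbd hde h2 with h6 | h6 <;>
    rw [h5, h6] at key
  · linarith [key 5 3 3 3]
  · have := key ((α + 1) * α) (-α) (-(α + 1)) (-(α + 1))
    nlinarith
  · have := key ((α + 1) * α) (-(α + 1)) (-α) (-(α + 1))
    nlinarith
  · linarith [key 4 5 5 (-4)]

/-- An edge leaving the end of an induced path closes it to an unbalanced quadrangle. -/
lemma quadrangle_of_path (h : SmallMinorsGE S c) (hS : S.IsSymm) (hc : -5 / 2 < c)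
    (hSZ : ∀ u v, ∃ z : ℤ, S u v = z) (hdiag : ∀ v, S v v ≤ -1) {a b d e : V} (hab : a ≠ b)
    (had : a ≠ d) (hae : a ≠ e) (hbd : b ≠ d) (hbe : b ≠ e) (hde : d ≠ e) (h1 : S a b ≠ 0)
    (h2 : S b d ≠ 0) (h3 : S a d = 0) (h4 : S b e = 0) (h5 : S a e ≠ 0) :
    S d e ≠ 0 ∧ S a b * S a e + S b d * S d e = 0 := by
  have ha := hdiag a
  have hb := hdiag b
  have hd := hdiag d
  have he := hdiag e
  have k1 := h.four hS hab had hae hbd hbe hde 3 (-3 * S a b) (2 * S a b * S b d) (-2 * S a e)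
  rw [h3, h4] at k1
  rcases h.entry hS hc hSZ hdiag hab with h6 | h6 | h6 <;>
  rcases h.entry hS hc hSZ hdiag hbd with h7 | h7 | h7 <;>
  rcases h.entry hS hc hSZ hdiag hae with h8 | h8 | h8 <;>
  rcases h.entry hS hc hSZ hdiag hde with h9 | h9 | h9 <;>
  first
    | exact absurd h6 h1
    | exact absurd h7 h2
    | exact absurd h8 h5
    | (rw [h6, h7, h8, h9]; norm_num; done)
    | (exfalso; rw [h6, h7, h8, h9] at k1; linarith)

lemma eigen_row {V : Type} [Fintype V] {S : Matrix V V ℝ} {μ : ℝ} {x : V → ℝ}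
    (hx : S *ᵥ x = μ • x) (v : V) (T : Finset V) (hT : ∀ u ∉ T, S v u = 0) :
    μ * x v = ∑ u ∈ T, S v u * x u := by
  have h := congrFun hx v
  simp only [mulVec, dotProduct, Pi.smul_apply, smul_eq_mul] at h
  rw [← h]
  symm
  exact Finset.sum_subset (Finset.subset_univ T) fun u _ hu ↦ by rw [hT u hu, zero_mul]

/-- An eigenvector for an eigenvalue below `-1 - √2` vanishes on induced paths. -/
lemma eigenvector_path [Fintype V] (h : SmallMinorsGE S c) (hS : S.IsSymm) {α : ℝ}
    (hα : IsLeast {x : ℝ | x ^ 3 + 2 * x ^ 2 - 2 * x - 2 = 0} α) (hc : α < c)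
    (hSZ : ∀ u v, ∃ z : ℤ, S u v = z) (hdiag : ∀ v, S v v ≤ -1) {μ : ℝ} {x : V → ℝ}
    (hx : S *ᵥ x = μ • x) (hμ : μ < -1 - Real.sqrt 2) {a b d : V} (hab : a ≠ b)
    (had : a ≠ d) (hbd : b ≠ d) (h1 : S a b ≠ 0) (h2 : S b d ≠ 0) (h3 : S a d = 0) :
    x a = 0 ∧ x b = 0 := by
  have hc' : -5 / 2 < c := (cubic_root_bounds hα).1.trans hc
  have hsq2 := Real.sq_sqrt (show (0 : ℝ) ≤ 2 by norm_num)
  have hsq0 := Real.sqrt_nonneg 2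
  have hν : (μ + 1) ^ 2 - 2 ≠ 0 := by nlinarith
  have hsq : ∀ {u v}, u ≠ v → S u v ≠ 0 → S u v ^ 2 = 1 := by
    intro u v hv h0
    rcases h.entry hS hc' hSZ hdiag hv with h5 | h5 | h5
    · exact absurd h5 h0
    all_goals rw [h5]; norm_num
  have hda := h.diag_eq hS hc' hSZ hdiag hab h1
  have hdb := h.diag_eq hS hc' hSZ hdiag hbd h2
  have hdd := h.diag_eq hS hc' hSZ hdiag hbd.symm (by rwa [hS.apply])
  have h1' : S b a ≠ 0 := by rwa [hS.apply]
  have h2' : S d b ≠ 0 := by rwa [hS.apply]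
  have h3' : S d a = 0 := by rwa [hS.apply]
  have nb : ∀ e, e ≠ a → e ≠ b → e ≠ d → S b e = 0 := fun e ea eb ed ↦
    h.eq_zero_of_path hS hα hc hSZ hdiag hab.symm hbd eb.symm had ea.symm ed.symm h1' h2 h3
  have rb : μ * x b = S b a * x a + (S b b * x b + S b d * x d) := by
    rw [eigen_row hx b {a, b, d} (by simpa using nb)]
    simp [Finset.sum_insert, hab, had, hbd]
  rw [hdb, hS.apply] at rb
  have sab := hsq hab h1
  have sbd := hsq hbd h2
  by_cases hq : ∃ e, e ≠ a ∧ e ≠ b ∧ e ≠ d ∧ (S a e ≠ 0 ∨ S d e ≠ 0)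
  · obtain ⟨e, ea, eb, ed, he⟩ := hq
    have hbe := nb e ea eb ed
    have hquad : S a e ≠ 0 ∧ S d e ≠ 0 ∧ S a b * S a e + S b d * S d e = 0 := by
      rcases he with he | he
      · have := h.quadrangle_of_path hS hc' hSZ hdiag hab had ea.symm hbd eb.symm ed.symm
          h1 h2 h3 hbe he
        exact ⟨he, this⟩
      · have := h.quadrangle_of_path hS hc' hSZ hdiag hbd.symm had.symm ed.symm hab.symm eb.symm
          ea.symm h2' h1' h3' hbe he
        rw [hS.apply b d, hS.apply a b] at this
        exact ⟨this.1, he, by linarith [this.2]⟩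
    obtain ⟨hae, hde, hsum⟩ := hquad
    have hea : S e a ≠ 0 := by rwa [hS.apply]
    have hed : S e d ≠ 0 := by rwa [hS.apply]
    have hdee := h.diag_eq hS hc' hSZ hdiag ea hea
    have sae := hsq ea.symm hae
    have ra : μ * x a = S a a * x a + (S a b * x b + S a e * x e) := by
      rw [eigen_row hx a {a, b, e} (by
        intro u hu
        simp only [mem_insert, mem_singleton, not_or] at hu
        exact h.eq_zero_of_path hS hα hc hSZ hdiag hab ea.symm (Ne.symm hu.1) eb.symm
          (Ne.symm hu.2.1) (Ne.symm hu.2.2) h1 hae hbe)]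
      simp [Finset.sum_insert, hab, ea.symm, eb.symm]
    have rd : μ * x d = S d b * x b + (S d d * x d + S d e * x e) := by
      rw [eigen_row hx d {b, d, e} (by
        intro u hu
        simp only [mem_insert, mem_singleton, not_or] at hu
        exact h.eq_zero_of_path hS hα hc hSZ hdiag hbd.symm ed.symm (Ne.symm hu.2.1) eb.symm
          (Ne.symm hu.1) (Ne.symm hu.2.2) h2' hde hbe)]
      simp [Finset.sum_insert, hbd, ed.symm, eb.symm]
    have re : μ * x e = S e a * x a + (S e d * x d + S e e * x e) := by
      rw [eigen_row hx e {a, d, e} (by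
        intro u hu
        simp only [mem_insert, mem_singleton, not_or] at hu
        exact h.eq_zero_of_path hS hα hc hSZ hdiag ea ed (Ne.symm hu.2.2) had
          (Ne.symm hu.1) (Ne.symm hu.2.1) hea hed h3)]
      simp [Finset.sum_insert, had, ed.symm, ea.symm]
    rw [hda] at ra
    rw [hdd, hS.apply b d] at rd
    rw [hdee, hS.apply a e, hS.apply d e] at re
    have hsum' : S a b * S b d + S a e * S d e = 0 := by
      linear_combination S a e * S b d * hsum - S a b * S b d * sae - S a e * S d e * sbd
    constructor <;> refine (mul_eq_zero.mp ?_).resolve_left hν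
    · linear_combination (μ + 1) * ra + S a b * rb + S a e * re + x a * (sab + sae) + x d * hsum'
    · linear_combination (μ + 1) * rb + S a b * ra + S b d * rd + x b * (sab + sbd) + x e * hsum
  · push Not at hq
    have ra : μ * x a = S a a * x a + S a b * x b := by
      rw [eigen_row hx a {a, b} (by
        intro u hu
        simp only [mem_insert, mem_singleton, not_or] at hu
        by_cases hud : u = d
        · rwa [hud]
        · exact (hq u hu.1 hu.2 hud).1)]
      simp [hab]
    have rd : μ * x d = S d b * x b + S d d * x d := by
      rw [eigen_row hx d {b, d} (by
        intro u hu
        simp only [mem_insert, mem_singleton, not_or] at hu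
        by_cases hua : u = a
        · rwa [hua]
        · exact (hq u hua hu.1 hu.2).2)]
      simp [hbd]
    rw [hda] at ra
    rw [hdd, hS.apply b d] at rd
    have hb0 : x b = 0 := by
      refine (mul_eq_zero.mp ?_).resolve_left hν
      linear_combination (μ + 1) * rb + S a b * ra + S b d * rd + x b * sab + x b * sbd
    refine ⟨?_, hb0⟩
    rw [hb0] at ra
    have hμ1 : μ + 1 ≠ 0 := by linarith
    refine (mul_eq_zero.mp ?_).resolve_left hμ1
    linear_combination ra

lemma neg_one_sub_sqrt_two_le [Fintype V] (h : SmallMinorsGE S c) (hS : S.IsSymm) {α : ℝ}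
    (hα : IsLeast {x : ℝ | x ^ 3 + 2 * x ^ 2 - 2 * x - 2 = 0} α) (hc : α < c)
    (hSZ : ∀ u v, ∃ z : ℤ, S u v = z) (hdiag : ∀ v, S v v ≤ -1) {μ : ℝ} {x : V → ℝ}
    (hx0 : x ≠ 0) (hx : S *ᵥ x = μ • x) : -1 - Real.sqrt 2 ≤ μ := by
  by_contra! hμ
  have hc' : -5 / 2 < c := (cubic_root_bounds hα).1.trans hc
  have hs1 : 1 < Real.sqrt 2 := by
    rw [Real.lt_sqrt] <;> norm_num
  have hsq : ∀ {u v}, u ≠ v → S u v ≠ 0 → S u v ^ 2 = 1 := by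
    intro u v hv h0
    rcases h.entry hS hc' hSZ hdiag hv with h5 | h5 | h5
    · exact absurd h5 h0
    all_goals rw [h5]; norm_num
  obtain ⟨v, hv⟩ := Function.ne_iff.mp hx0
  simp only [Pi.zero_apply] at hv
  have path : ∀ {a b d}, a ≠ b → a ≠ d → b ≠ d → S a b ≠ 0 → S b d ≠ 0 → S a d = 0 →
      x a = 0 ∧ x b = 0 := fun h1 h2 h3 h4 h5 h6 ↦
    h.eigenvector_path hS hα hc hSZ hdiag hx hμ h1 h2 h3 h4 h5 h6
  set C : Finset V := {u | S v u ≠ 0} with hC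
  set σ : V → ℝ := fun u ↦ if u = v then 1 else S v u with hσ
  have hvv : S v v ≠ 0 := by linarith [hdiag v]
  have hσ2 : ∀ u ∈ C, σ u ^ 2 = 1 := by
    intro u hu
    simp only [hσ]
    split_ifs with huv
    · norm_num
    · exact hsq (Ne.symm huv) (by simpa [hC] using hu)
  have hvC : v ∈ C := by simpa [hC] using hvv
  by_cases hiso : ∀ u, u ≠ v → S v u = 0
  · have := eigen_row hx v {v} (by simpa using hiso)
    rw [sum_singleton] at this
    have h2 := h.one v
    have h3 := mul_right_cancel₀ hv this
    obtain ⟨z, hz⟩ := hSZ v v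
    rw [hz] at h2 h3
    have h4 : (-3 : ℝ) < z := by linarith
    have h5 : -3 < z := by exact_mod_cast h4
    have h6 : (-2 : ℝ) ≤ z := by exact_mod_cast (show -2 ≤ z by omega)
    linarith
  push Not at hiso
  obtain ⟨w₀, hw₀, hw₀'⟩ := hiso
  have hdv : S v v = -1 := h.diag_eq hS hc' hSZ hdiag hw₀.symm hw₀'
  have hrow : ∀ u ∈ C, (μ + 2) * x u = σ u * ∑ w ∈ C, σ w * x w := by
    intro u hu
    have hu' : S v u ≠ 0 := by simpa [hC] using hu
    have hout : ∀ w ∉ C, S u w = 0 := by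
      intro w hw
      have hw' : S v w = 0 := by simpa [hC] using hw
      by_cases huv : u = v
      · rwa [huv]
      by_contra hne
      have hvw : v ≠ w := by rintro rfl; exact hvv hw'
      have huw : u ≠ w := by rintro rfl; exact hu' hw'
      exact hv (path (Ne.symm huv) hvw huw hu' hne hw').1
    have hentry : ∀ w ∈ C, S u w = σ u * σ w - if w = u then 2 else 0 := by
      intro w hw
      have hw' : S v w ≠ 0 := by simpa [hC] using hw
      by_cases huw : w = u
      · subst huw
        have h5 := hσ2 w hw
        have h6 : S w w = -1 := by
          by_cases hwv : w = v
          · rwa [hwv]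
          · exact h.diag_eq hS hc' hSZ hdiag hwv (by rwa [hS.apply])
        rw [h6, if_pos rfl]; linear_combination -h5
      rw [if_neg huw, sub_zero]
      simp only [hσ]
      by_cases huv : u = v
      · subst huv; simp [huw]
      by_cases hwv : w = v
      · subst hwv; simp [huv, hS.apply u w]
      rw [if_neg huv, if_neg hwv]
      have hne : S u w ≠ 0 := by
        intro h0
        exact hv (path huv (Ne.symm huw) (Ne.symm hwv) (by rwa [hS.apply]) hw' h0).2
      exact h.triangle hS hc' hSZ hdiag (Ne.symm huv) (Ne.symm hwv) (Ne.symm huw) hu' hw' hne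
    have h5 := eigen_row hx u C hout
    have h6 : ∑ w ∈ C, S u w * x w = σ u * ∑ w ∈ C, σ w * x w - 2 * x u := by
      rw [Finset.sum_congr rfl fun w hw ↦ by rw [hentry w hw, sub_mul], Finset.sum_sub_distrib,
        Finset.mul_sum]
      congr 1
      · exact Finset.sum_congr rfl fun w _ ↦ by ring
      · simp [hu]
    linarith
  set T := ∑ w ∈ C, σ w * x w with hT
  have hT2 : (μ + 2) * T = #C * T := by
    rw [hT, Finset.mul_sum, ← nsmul_eq_mul, ← Finset.sum_const]
    refine Finset.sum_congr rfl fun u hu ↦ ?_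
    rw [← hT]
    linear_combination σ u * hrow u hu + T * hσ2 u hu
  have hT0 : T = 0 := by
    have h7 : (μ + 2 - #C) * T = 0 := by linarith
    refine (mul_eq_zero.mp h7).resolve_left ?_
    have : (0 : ℝ) ≤ #C := Nat.cast_nonneg _
    linarith
  have h8 := hrow v hvC
  rw [hT0, mul_zero] at h8
  exact (mul_ne_zero (by linarith) hv) h8

end SmallMinorsGE

/-- A vector approximately dual to a few nearly orthogonal long vectors satisfies a Bessel-type
inequality with respect to a positive semidefinite form. -/
lemma sum_sq_le_of_almost_orthogonal {E ι : Type} [AddCommGroup E] [Module ℝ E]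
    (B : LinearMap.BilinForm ℝ E) (hB : B.IsSymm) (hpos : ∀ y, 0 ≤ B y y) (H : Finset ι)
    (z : ι → E) (s : ι → ℝ) (x : E) {X c N : ℝ} (hN : 0 < N) (hX : 0 ≤ X)
    (hs : ∀ i ∈ H, |s i| ≤ X) (h1 : ∀ i ∈ H, |B x (z i) - N * s i| ≤ c * X)
    (h2 : ∀ i ∈ H, ∀ j ∈ H, |B (z i) (z j) - if i = j then N ^ 2 else 0| ≤ c * N) :
    ∑ i ∈ H, s i ^ 2 - (2 * #H + #H ^ 2) * c * X ^ 2 / N ≤ B x x := by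
  have h := hpos (x - ∑ i ∈ H, (s i / N) • z i)
  simp only [map_sub, LinearMap.sub_apply, map_sum, LinearMap.sum_apply, map_smul,
    LinearMap.smul_apply, smul_eq_mul] at h
  have e1 : ∑ i ∈ H, s i / N * B (z i) x = ∑ i ∈ H, s i / N * B x (z i) :=
    Finset.sum_congr rfl fun i _ ↦ by rw [← hB.eq x (z i)]
  rw [e1] at h
  have b1 : ∑ i ∈ H, s i ^ 2 - #H * (c * X ^ 2 / N) ≤ ∑ i ∈ H, s i / N * B x (z i) := by
    rw [← nsmul_eq_mul, ← Finset.sum_const, ← Finset.sum_sub_distrib]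
    refine Finset.sum_le_sum fun i hi ↦ ?_
    have h3 : |s i / N * (B x (z i) - N * s i)| ≤ X / N * (c * X) := by
      rw [abs_mul, abs_div, abs_of_pos hN]
      exact mul_le_mul (div_le_div_of_nonneg_right (hs i hi) hN.le) (h1 i hi) (abs_nonneg _)
        (div_nonneg hX hN.le)
    have h4 := (abs_le.mp h3).1
    have h5 : s i / N * (B x (z i) - N * s i) = s i / N * B x (z i) - s i ^ 2 := by
      field_simp
    have h6 : X / N * (c * X) = c * X ^ 2 / N := by ring
    linarith
  have b2 : ∑ i ∈ H, ∑ j ∈ H, s i / N * (s j / N * B (z i) (z j)) ≤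
      ∑ i ∈ H, s i ^ 2 + #H ^ 2 * (c * X ^ 2 / N) := by
    have h3 : ∀ i ∈ H, ∑ j ∈ H, s i / N * (s j / N * B (z i) (z j)) ≤
        s i ^ 2 + #H * (c * X ^ 2 / N) := by
      intro i hi
      have h4 : s i ^ 2 = ∑ j ∈ H, if i = j then s i ^ 2 else 0 := by simp [hi]
      rw [h4, ← nsmul_eq_mul, ← Finset.sum_const, ← Finset.sum_add_distrib]
      refine Finset.sum_le_sum fun j hj ↦ ?_
      have h5 : |s i / N * (s j / N) * (B (z i) (z j) - if i = j then N ^ 2 else 0)| ≤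
          X / N * (X / N) * (c * N) := by
        rw [abs_mul, abs_mul, abs_div, abs_div, abs_of_pos hN]
        have h6 := div_le_div_of_nonneg_right (hs i hi) hN.le
        have h7 := div_le_div_of_nonneg_right (hs j hj) hN.le
        refine mul_le_mul (mul_le_mul h6 h7 (by positivity) (by positivity)) (h2 i hi j hj)
          (abs_nonneg _) (by positivity)
      have h6 := (abs_le.mp h5).2
      have h7 : X / N * (X / N) * (c * N) = c * X ^ 2 / N := by field_simp
      rw [h7, mul_sub] at h6
      have h8 : s i / N * (s j / N) * (if i = j then N ^ 2 else 0) =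
          if i = j then s i ^ 2 else 0 := by
        split_ifs with hij
        · subst hij; field_simp
        · simp
      rw [h8] at h6
      linarith
    refine (Finset.sum_le_sum h3).trans (le_of_eq ?_)
    rw [Finset.sum_add_distrib, Finset.sum_const, nsmul_eq_mul]
    ring
  have h9 : (2 * #H + #H ^ 2) * c * X ^ 2 / N =
      2 * (#H * (c * X ^ 2 / N)) + #H ^ 2 * (c * X ^ 2 / N) := by ring
  rw [h9]
  simp only [mul_sub, Finset.sum_sub_distrib, Finset.mul_sum] at h
  have h10 : ∑ i ∈ H, ∑ j ∈ H, s i / N * (s j / N * B (z j) (z i)) =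
    ∑ i ∈ H, ∑ j ∈ H, s i / N * (s j / N * B (z i) (z j)) := by
    refine Finset.sum_congr rfl fun i _ ↦ Finset.sum_congr rfl fun j _ ↦ by
      rw [← hB.eq (z i) (z j)]
  linarith

lemma exists_indep_or_clique {V : Type} {G : SimpleGraph V} (s t : ℕ) (W : Finset V)
    (hW : 2 ^ (s + t) ≤ #W) :
    (∃ I ⊆ W, #I = s ∧ ∀ u ∈ I, ∀ w ∈ I, ¬ G.Adj u w) ∨
      ∃ K ⊆ W, #K = t ∧ G.IsClique K := by
  induction hn : s + t generalizing s t W with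
  | zero =>
    left
    exact ⟨∅, by simp, by simp; omega, by simp⟩
  | succ n ih =>
    rcases Nat.eq_zero_or_pos s with rfl | hs
    · exact Or.inl ⟨∅, by simp, by simp, by simp⟩
    rcases Nat.eq_zero_or_pos t with rfl | ht
    · exact Or.inr ⟨∅, by simp, by simp, by simp⟩
    rw [hn, pow_succ] at hW
    have hpos : 0 < 2 ^ n := by positivity
    obtain ⟨v, hv⟩ : W.Nonempty := Finset.card_pos.mp (by omega)
    have hcard := Finset.card_filter_add_card_filter_not (s := W.erase v) (fun w ↦ G.Adj v w)
    rw [Finset.card_erase_of_mem hv] at hcard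
    by_cases hA : 2 ^ n ≤ #{w ∈ W.erase v | G.Adj v w}
    · rcases ih s (t - 1) _ (by convert hA using 2; omega) (by omega) with
        ⟨I, hI, h1, h2⟩ | ⟨K, hK, h1, h2⟩
      · exact Or.inl ⟨I, hI.trans ((filter_subset _ _).trans (erase_subset _ _)), h1, h2⟩
      · right
        have hvK : v ∉ K := fun h ↦ by simpa using hK h
        refine ⟨insert v K, ?_, by rw [card_insert_of_notMem hvK]; omega, ?_⟩
        · exact insert_subset hv (hK.trans ((filter_subset _ _).trans (erase_subset _ _)))
        · rw [coe_insert, SimpleGraph.isClique_insert]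
          exact ⟨h2, fun u hu _ ↦ (mem_filter.mp (hK hu)).2⟩
    · rcases ih (s - 1) t {w ∈ W.erase v | ¬ G.Adj v w}
        (by rw [show s - 1 + t = n by omega]; omega) (by omega) with
        ⟨I, hI, h1, h2⟩ | ⟨K, hK, h1, h2⟩
      · left
        have hvI : v ∉ I := fun h ↦ by simpa using hI h
        have hvn : ∀ u ∈ I, ¬ G.Adj v u := fun u hu ↦ (mem_filter.mp (hI hu)).2
        refine ⟨insert v I, ?_, by rw [card_insert_of_notMem hvI]; omega, ?_⟩
        · exact insert_subset hv (hI.trans ((filter_subset _ _).trans (erase_subset _ _)))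
        · intro u hu w hw
          rcases mem_insert.mp hu with hu' | hu' <;>
            rcases mem_insert.mp hw with hw' | hw'
          · rw [hu', hw']; exact G.irrefl
          · rw [hu']; exact hvn w hw'
          · rw [hw']; exact fun h ↦ hvn u hu' h.symm
          · exact h2 u hu' w hw'
      · exact Or.inr ⟨K, hK.trans ((filter_subset _ _).trans (erase_subset _ _)), h1, h2⟩

section Cliques

variable {V : Type} [Fintype V] (G : SimpleGraph V)

/-- The characteristic vector of a set of vertices. -/
noncomputable def charVec (s : Finset V) : V → ℝ := fun v ↦ if v ∈ s then 1 else 0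

lemma dotProduct_charVec (x : V → ℝ) (s : Finset V) : x ⬝ᵥ charVec s = ∑ v ∈ s, x v := by
  simp [charVec, dotProduct]

lemma charVec_dotProduct_charVec (s t : Finset V) : charVec s ⬝ᵥ charVec t = #(s ∩ t) := by
  rw [dotProduct_charVec, Finset.inter_comm]
  simp [charVec]

lemma charVec_adjMatrix_charVec (s t : Finset V) :
    charVec s ⬝ᵥ G.adjMatrix ℝ *ᵥ charVec t = ∑ u ∈ s, (#{v ∈ t | G.Adj u v} : ℝ) := by
  rw [dotProduct_comm, dotProduct_charVec]
  refine Finset.sum_congr rfl fun u _ ↦ ?_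
  rw [mulVec, dotProduct_charVec]
  simp [SimpleGraph.adjMatrix_apply]

lemma adjMatrix_form_symm (x y : V → ℝ) :
    x ⬝ᵥ G.adjMatrix ℝ *ᵥ y = y ⬝ᵥ G.adjMatrix ℝ *ᵥ x := by
  rw [dotProduct_mulVec, dotProduct_comm, ← mulVec_transpose, G.transpose_adjMatrix]

lemma charVec_adjMatrix_charVec_self {s : Finset V} (hs : G.IsClique s) :
    charVec s ⬝ᵥ G.adjMatrix ℝ *ᵥ charVec s = #s * (#s - 1) := by
  rw [charVec_adjMatrix_charVec, ← nsmul_eq_mul, ← Finset.sum_const]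
  refine Finset.sum_congr rfl fun u hu ↦ ?_
  have : ({v ∈ s | G.Adj u v} : Finset V) = s.erase u := by
    ext v
    simp only [mem_filter, mem_erase]
    exact ⟨fun h ↦ ⟨h.2.ne', h.1⟩, fun h ↦ ⟨h.2, hs hu h.2 h.1.symm⟩⟩
  rw [this, Finset.cast_card_erase_of_mem hu]

lemma charVec_adjMatrix_charVec_of_forall_adj {s t : Finset V}
    (h : ∀ u ∈ s, ∀ v ∈ t, G.Adj u v) :
    charVec s ⬝ᵥ G.adjMatrix ℝ *ᵥ charVec t = #s * #t := by
  rw [charVec_adjMatrix_charVec, ← nsmul_eq_mul, ← Finset.sum_const]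
  refine Finset.sum_congr rfl fun u hu ↦ ?_
  rw [Finset.filter_true_of_mem (h u hu)]

lemma charVec_adjMatrix_charVec_of_forall_not_adj {s t : Finset V}
    (h : ∀ u ∈ s, ∀ v ∈ t, ¬ G.Adj u v) :
    charVec s ⬝ᵥ G.adjMatrix ℝ *ᵥ charVec t = 0 := by
  rw [charVec_adjMatrix_charVec]
  refine Finset.sum_eq_zero fun u hu ↦ ?_
  rw [Finset.filter_false_of_mem (h u hu)]
  simp

variable {G}

lemma not_indep_of_forall_adj (hG : ∀ y : V → ℝ, -5 / 2 * (y ⬝ᵥ y) ≤ y ⬝ᵥ G.adjMatrix ℝ *ᵥ y)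
    {v : V} {I : Finset V} (hI : #I = 7) (hv : ∀ u ∈ I, G.Adj v u)
    (hind : ∀ u ∈ I, ∀ w ∈ I, ¬ G.Adj u w) : False := by
  have h := hG ((-8 : ℝ) • charVec {v} + (3 : ℝ) • charVec I)
  have hvI : v ∉ I := fun h ↦ G.irrefl (hv v h)
  simp only [mulVec_add, mulVec_smul, dotProduct_add, add_dotProduct, dotProduct_smul,
    smul_dotProduct, smul_eq_mul, adjMatrix_form_symm G (charVec I) (charVec {v}),
    charVec_dotProduct_charVec] at h
  rw [charVec_adjMatrix_charVec_of_forall_not_adj G hind,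
    charVec_adjMatrix_charVec_of_forall_not_adj G (s := {v}) (t := {v}) (by simp),
    charVec_adjMatrix_charVec_of_forall_adj G (s := {v}) (by simpa using hv)] at h
  simp [hI, hvI, Finset.inter_singleton_of_notMem, Finset.singleton_inter_of_notMem] at h
  norm_num at h

lemma not_half_adj_clique
    (hG : ∀ y : V → ℝ, -5 / 2 * (y ⬝ᵥ y) ≤ y ⬝ᵥ G.adjMatrix ℝ *ᵥ y)
    {v : V} {X Y : Finset V} (hX : 18 ≤ #X) (hY : 18 ≤ #Y) (hXc : G.IsClique X)
    (hYc : G.IsClique Y) (hXY : ∀ u ∈ X, ∀ w ∈ Y, G.Adj u w) (hvX : ∀ u ∈ X, G.Adj v u)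
    (hvY : ∀ u ∈ Y, ¬ G.Adj v u) : False := by
  obtain ⟨X, hX', hX⟩ := Finset.exists_subset_card_eq hX
  obtain ⟨Y, hY', hY⟩ := Finset.exists_subset_card_eq hY
  replace hXc : G.IsClique X := hXc.subset (by exact_mod_cast hX')
  replace hYc : G.IsClique Y := hYc.subset (by exact_mod_cast hY')
  replace hXY : ∀ u ∈ X, ∀ w ∈ Y, G.Adj u w := fun u hu w hw ↦ hXY u (hX' hu) w (hY' hw)
  replace hvX : ∀ u ∈ X, G.Adj v u := fun u hu ↦ hvX u (hX' hu)
  replace hvY : ∀ u ∈ Y, ¬ G.Adj v u := fun u hu ↦ hvY u (hY' hu)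
  have h1 : v ∉ X := fun h ↦ G.irrefl (hvX v h)
  have h2 : v ∉ Y := by
    intro hv
    obtain ⟨w, hw, hwv⟩ := Finset.exists_mem_ne (by omega) v (s := Y)
    exact hvY w hw (hYc hv hw hwv.symm)
  have h3 : X ∩ Y = ∅ := by
    ext u
    simp only [mem_inter, notMem_empty, iff_false, not_and]
    exact fun hu hu' ↦ G.irrefl (hXY u hu u hu')
  have h := hG ((6 : ℝ) • charVec {v} + (-1 : ℝ) • charVec X + charVec Y)
  simp only [mulVec_add, mulVec_smul, dotProduct_add, add_dotProduct, dotProduct_smul,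
    smul_dotProduct, smul_eq_mul, adjMatrix_form_symm G (charVec X) (charVec {v}),
    adjMatrix_form_symm G (charVec Y) (charVec {v}),
    adjMatrix_form_symm G (charVec Y) (charVec X), charVec_dotProduct_charVec] at h
  rw [charVec_adjMatrix_charVec_self G hXc, charVec_adjMatrix_charVec_self G hYc,
    charVec_adjMatrix_charVec_of_forall_not_adj G (s := {v}) (t := {v}) (by simp),
    charVec_adjMatrix_charVec_of_forall_adj G (s := {v}) (t := X) (by simpa using hvX),
    charVec_adjMatrix_charVec_of_forall_not_adj G (s := {v}) (t := Y) (by simpa using hvY),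
    charVec_adjMatrix_charVec_of_forall_adj G hXY] at h
  rw [Finset.inter_comm Y X] at h
  simp [hX, hY, h1, h2, h3, Finset.inter_singleton_of_notMem,
    Finset.singleton_inter_of_notMem] at h
  norm_num at h

variable (G) in
/-- The vertices adjacent to almost all of `Q`. -/
noncomputable def nearSet (Q : Finset V) : Finset V := {v | #{q ∈ Q | ¬ G.Adj v q} < 18}

lemma mem_nearSet {Q : Finset V} {v : V} : v ∈ nearSet G Q ↔ #{q ∈ Q | ¬ G.Adj v q} < 18 := by
  simp [nearSet]

lemma card_adj_lt_of_notMem_nearSet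
    (hG : ∀ y : V → ℝ, -5 / 2 * (y ⬝ᵥ y) ≤ y ⬝ᵥ G.adjMatrix ℝ *ᵥ y) {Q : Finset V}
    (hQ : G.IsClique Q) {v : V} (hv : v ∉ nearSet G Q) : #{q ∈ Q | G.Adj v q} < 18 := by
  by_contra! h
  rw [mem_nearSet, not_lt] at hv
  refine not_half_adj_clique hG h hv (hQ.subset (coe_subset.mpr (filter_subset _ _)))
    (hQ.subset (coe_subset.mpr (filter_subset _ _))) ?_ (v := v) (fun u hu ↦ (mem_filter.mp hu).2)
    fun u hu ↦ (mem_filter.mp hu).2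
  intro u hu w hw
  simp only [mem_filter] at hu hw
  exact hQ hu.1 hw.1 (by rintro rfl; exact hw.2 hu.2)

lemma card_mem_nearSet_lt (hG : ∀ y : V → ℝ, -5 / 2 * (y ⬝ᵥ y) ≤ y ⬝ᵥ G.adjMatrix ℝ *ᵥ y)
    {Q Q' : Finset V} (hQ : G.IsClique Q) (hQ' : G.IsClique Q') (hN : 360 ≤ #Q)
    {v : V} (hv : v ∈ nearSet G Q) (hv' : v ∉ nearSet G Q') :
    #{q ∈ Q' | q ∈ nearSet G Q} < 36 := by
  by_contra! h
  have h1 := card_adj_lt_of_notMem_nearSet hG hQ' hv'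
  have h2 := Finset.card_filter_add_card_filter_not
    (s := {q ∈ Q' | q ∈ nearSet G Q}) (fun q ↦ G.Adj v q)
  have h3 : #{q ∈ {q ∈ Q' | q ∈ nearSet G Q} | G.Adj v q} ≤ #{q ∈ Q' | G.Adj v q} :=
    card_le_card (filter_subset_filter _ (filter_subset _ _))
  obtain ⟨T, hT, hTc⟩ := Finset.exists_subset_card_eq
    (show 18 ≤ #{q ∈ {q ∈ Q' | q ∈ nearSet G Q} | ¬ G.Adj v q} by omega)
  have hTm : ∀ q ∈ T, q ∈ Q' ∧ q ∈ nearSet G Q ∧ ¬ G.Adj v q := by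
    intro q hq
    simpa [and_assoc] using hT hq
  set Q₀ : Finset V := {q ∈ Q | G.Adj v q ∧ ∀ u ∈ T, G.Adj u q} with hQ₀
  have hcov : Q ⊆ Q₀ ∪ ({q ∈ Q | ¬ G.Adj v q} ∪ T.biUnion fun u ↦ {q ∈ Q | ¬ G.Adj u q}) := by
    intro q hq
    simp only [hQ₀, mem_union, mem_filter, mem_biUnion]
    by_cases h4 : G.Adj v q
    · by_cases h5 : ∀ u ∈ T, G.Adj u q
      · exact Or.inl ⟨hq, h4, h5⟩
      · push Not at h5
        obtain ⟨u, hu, huq⟩ := h5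
        exact Or.inr (Or.inr ⟨u, hu, hq, huq⟩)
    · exact Or.inr (Or.inl ⟨hq, h4⟩)
  have h4 : #(T.biUnion fun u ↦ {q ∈ Q | ¬ G.Adj u q}) ≤ #T * 18 :=
    Finset.card_biUnion_le_card_mul _ _ _ fun u hu ↦ (mem_nearSet.mp (hTm u hu).2.1).le
  have h5 := (card_le_card hcov).trans (card_union_le _ _)
  have h6 := card_union_le {q ∈ Q | ¬ G.Adj v q} (T.biUnion fun u ↦ {q ∈ Q | ¬ G.Adj u q})
  have h7 := mem_nearSet.mp hv
  refine not_half_adj_clique hG (v := v) (X := Q₀) (Y := T) (by omega) (by omega)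
    (hQ.subset (coe_subset.mpr (filter_subset _ _))) (hQ'.subset fun q hq ↦ (hTm q hq).1) ?_ ?_
    fun u hu ↦ (hTm u hu).2.2
  · intro u hu w hw
    exact ((mem_filter.mp hu).2.2 w hw).symm
  · intro u hu
    exact (mem_filter.mp hu).2.1

lemma sum_card_adj_le (hG : ∀ y : V → ℝ, -5 / 2 * (y ⬝ᵥ y) ≤ y ⬝ᵥ G.adjMatrix ℝ *ᵥ y)
    {Q Q' : Finset V} {N : ℕ} (hQ : G.IsClique Q) (hQ' : G.IsClique Q') (hN : 360 ≤ N)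
    (hQN : #Q = N) (hQN' : #Q' = N) {v : V} (hv : v ∈ nearSet G Q) (hv' : v ∉ nearSet G Q') :
    charVec Q' ⬝ᵥ G.adjMatrix ℝ *ᵥ charVec Q ≤ 54 * N := by
  rw [charVec_adjMatrix_charVec,
    ← Finset.sum_filter_add_sum_filter_not Q' (fun q ↦ q ∈ nearSet G Q)]
  have h1 : ∑ u ∈ Q' with u ∈ nearSet G Q, (#{v ∈ Q | G.Adj u v} : ℝ) ≤ 36 * N := by
    refine (Finset.sum_le_card_nsmul _ _ (N : ℝ) fun u _ ↦ ?_).trans ?_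
    · exact_mod_cast (card_filter_le _ _).trans hQN.le
    · rw [nsmul_eq_mul]
      refine mul_le_mul_of_nonneg_right ?_ (Nat.cast_nonneg _)
      exact_mod_cast (card_mem_nearSet_lt hG hQ hQ' (by omega) hv hv').le
  have h2 : ∑ u ∈ Q' with u ∉ nearSet G Q, (#{v ∈ Q | G.Adj u v} : ℝ) ≤ N * 18 := by
    refine (Finset.sum_le_card_nsmul _ _ (18 : ℝ) fun u hu ↦ ?_).trans ?_
    · exact_mod_cast (card_adj_lt_of_notMem_nearSet hG hQ (mem_filter.mp hu).2).le
    · rw [nsmul_eq_mul]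
      refine mul_le_mul_of_nonneg_right ?_ (by norm_num)
      exact_mod_cast (card_filter_le _ _).trans hQN'.le
  linarith

lemma charVec_adjMatrix_charVec_le
    (hG : ∀ y : V → ℝ, -5 / 2 * (y ⬝ᵥ y) ≤ y ⬝ᵥ G.adjMatrix ℝ *ᵥ y)
    {Q Q' : Finset V} {N : ℕ} (hQ : G.IsClique Q) (hQ' : G.IsClique Q') (hN : 360 ≤ N)
    (hQN : #Q = N) (hQN' : #Q' = N) (hne : nearSet G Q ≠ nearSet G Q') :
    charVec Q ⬝ᵥ G.adjMatrix ℝ *ᵥ charVec Q' ≤ 54 * N := by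
  by_cases h : nearSet G Q ⊆ nearSet G Q'
  · have h' : ¬ nearSet G Q' ⊆ nearSet G Q := fun h' ↦ hne (h.antisymm h')
    obtain ⟨v, hv, hv'⟩ := Finset.not_subset.mp h'
    exact sum_card_adj_le hG hQ' hQ hN hQN' hQN hv hv'
  · obtain ⟨v, hv, hv'⟩ := Finset.not_subset.mp h
    rw [adjMatrix_form_symm]
    exact sum_card_adj_le hG hQ hQ' hN hQN hQN' hv hv'

variable (G) in
/-- The sets of vertices adjacent to almost all of some clique of order `N`. -/
noncomputable def quasiCliques (N : ℕ) : Finset (Finset V) :=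
  ({Q : Finset V | G.IsClique Q ∧ #Q = N} : Finset (Finset V)).image (nearSet G)

lemma exists_mem_quasiCliques
    (hG : ∀ y : V → ℝ, -5 / 2 * (y ⬝ᵥ y) ≤ y ⬝ᵥ G.adjMatrix ℝ *ᵥ y) {N : ℕ} {v : V}
    (hv : 2 ^ (7 + N) ≤ G.degree v) : ∃ f ∈ quasiCliques G N, v ∈ f := by
  rw [← G.card_neighborFinset_eq_degree] at hv
  rcases exists_indep_or_clique (G := G) 7 N _ hv with ⟨I, hI, h1, h2⟩ | ⟨K, hK, h1, h2⟩
  · exact (not_indep_of_forall_adj hG h1 (fun u hu ↦ by simpa using hI hu) h2).elim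
  · refine ⟨nearSet G K, mem_image.mpr ⟨K, by simp [h1, h2], rfl⟩, ?_⟩
    rw [mem_nearSet, filter_false_of_mem]
    · simp
    · exact fun u hu ↦ not_not.mpr (by simpa using hK hu)

/-- The effect of replacing quasi-cliques by fat vertices on the quadratic form. -/
lemma quadratic_form_ge_sum_sq {l : ℝ} (hl : -5 / 2 ≤ l) (hl0 : l ≤ 0)
    (hG : ∀ y : V → ℝ, l * (y ⬝ᵥ y) ≤ y ⬝ᵥ G.adjMatrix ℝ *ᵥ y) {N : ℕ} (hN : 360 ≤ N)
    {H : Finset (Finset V)} (hH : H ⊆ quasiCliques G N) (hH8 : #H ≤ 8) (x : V → ℝ) :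
    l * (x ⬝ᵥ x) + ∑ f ∈ H, (∑ v ∈ f, x v) ^ 2 - 4800 * (∑ v, |x v|) ^ 2 / N ≤
      x ⬝ᵥ G.adjMatrix ℝ *ᵥ x := by
  have hG' : ∀ y : V → ℝ, -5 / 2 * (y ⬝ᵥ y) ≤ y ⬝ᵥ G.adjMatrix ℝ *ᵥ y := fun y ↦
    (mul_le_mul_of_nonneg_right hl (by simpa using dotProduct_star_self_nonneg y)).trans (hG y)
  have hN0 : (0 : ℝ) < N := by exact_mod_cast (show 0 < N by omega)
  have hex : ∀ f ∈ H, ∃ Q : Finset V, G.IsClique Q ∧ #Q = N ∧ nearSet G Q = f := by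
    intro f hf
    obtain ⟨Q, hQ, rfl⟩ := mem_image.mp (hH hf)
    exact ⟨Q, (mem_filter.mp hQ).2.1, (mem_filter.mp hQ).2.2, rfl⟩
  choose! Q hQc hQN hQf using hex
  set B : LinearMap.BilinForm ℝ (V → ℝ) :=
    Matrix.toBilin' (G.adjMatrix ℝ) - l • Matrix.toBilin' 1 with hBdef
  have hB : ∀ y z, B y z = y ⬝ᵥ G.adjMatrix ℝ *ᵥ z - l * (y ⬝ᵥ z) := by
    intro y z
    simp [hBdef, Matrix.toBilin'_apply']
  have hX : 0 ≤ ∑ v, |x v| := Finset.sum_nonneg fun v _ ↦ abs_nonneg _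
  have key := sum_sq_le_of_almost_orthogonal B
    ⟨fun y z ↦ by simp only [hB, adjMatrix_form_symm G y z, dotProduct_comm y z]⟩
    (fun y ↦ by rw [hB]; linarith [hG y]) H (fun f ↦ charVec (Q f)) (fun f ↦ ∑ v ∈ f, x v) x
    (X := ∑ v, |x v|) (c := 60) (N := N) hN0 hX ?_ ?_ ?_
  · rw [hB] at key
    have h1 : (2 * (#H : ℝ) + (#H : ℝ) ^ 2) * 60 * (∑ v, |x v|) ^ 2 / N ≤
        4800 * (∑ v, |x v|) ^ 2 / N := by
      have h8 : (#H : ℝ) ≤ 8 := by exact_mod_cast hH8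
      have h0 : (0 : ℝ) ≤ #H := Nat.cast_nonneg _
      gcongr
      nlinarith
    linarith
  · intro f _
    exact (Finset.abs_sum_le_sum_abs _ _).trans
      (Finset.sum_le_sum_of_subset_of_nonneg (subset_univ _) fun v _ _ ↦ abs_nonneg _)
  · intro f hf
    have h1 : x ⬝ᵥ G.adjMatrix ℝ *ᵥ charVec (Q f) =
        ∑ v, x v * (#{q ∈ Q f | G.Adj v q} : ℝ) := by
      rw [dotProduct]
      refine Finset.sum_congr rfl fun v _ ↦ ?_
      rw [mulVec, dotProduct_charVec]
      simp [SimpleGraph.adjMatrix_apply]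
    have h2 : x ⬝ᵥ charVec (Q f) = ∑ v, x v * charVec (Q f) v := rfl
    have h3 : ∑ v ∈ f, x v = ∑ v, x v * if v ∈ f then 1 else 0 := by simp
    rw [hB, h1, h2, h3, Finset.mul_sum, Finset.mul_sum, ← Finset.sum_sub_distrib,
      ← Finset.sum_sub_distrib, Finset.mul_sum]
    refine (Finset.abs_sum_le_sum_abs _ _).trans (Finset.sum_le_sum fun v _ ↦ ?_)
    have h4 : x v * (#{q ∈ Q f | G.Adj v q} : ℝ) - l * (x v * charVec (Q f) v) -
        N * (x v * if v ∈ f then 1 else 0) = ((#{q ∈ Q f | G.Adj v q} : ℝ) -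
          l * charVec (Q f) v - N * if v ∈ f then 1 else 0) * x v := by ring
    rw [h4, abs_mul]
    refine mul_le_mul_of_nonneg_right ?_ (abs_nonneg _)
    have h5 : 0 ≤ - l * charVec (Q f) v ∧ - l * charVec (Q f) v ≤ 3 := by
      unfold charVec
      split_ifs <;> constructor <;> linarith
    have h6 := Finset.card_filter_add_card_filter_not (s := Q f) (fun q ↦ G.Adj v q)
    rw [hQN f hf] at h6
    have h6' : (#{q ∈ Q f | G.Adj v q} : ℝ) + #{q ∈ Q f | ¬ G.Adj v q} = N := by exact_mod_cast h6
    by_cases hvf : v ∈ f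
    · rw [if_pos hvf]
      rw [← hQf f hf, mem_nearSet] at hvf
      have h7 : (#{q ∈ Q f | ¬ G.Adj v q} : ℝ) ≤ 18 := by exact_mod_cast hvf.le
      have h8 : (0 : ℝ) ≤ #{q ∈ Q f | ¬ G.Adj v q} := Nat.cast_nonneg _
      rw [abs_le]
      constructor <;> linarith
    · rw [if_neg hvf]
      rw [← hQf f hf] at hvf
      have h7 : (#{q ∈ Q f | G.Adj v q} : ℝ) ≤ 18 := by
        exact_mod_cast (card_adj_lt_of_notMem_nearSet hG' (hQc f hf) hvf).le
      have h8 : (0 : ℝ) ≤ #{q ∈ Q f | G.Adj v q} := Nat.cast_nonneg _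
      rw [abs_le]
      constructor <;> linarith
  · intro f hf f' hf'
    simp only [hB, charVec_dotProduct_charVec]
    have h0 : (0 : ℝ) ≤ #(Q f ∩ Q f') := Nat.cast_nonneg _
    have h1 : (#(Q f ∩ Q f') : ℝ) ≤ N := by
      rw [← hQN f hf]
      exact_mod_cast card_le_card inter_subset_left
    have h2 : 0 ≤ - l * #(Q f ∩ Q f') := mul_nonneg (by linarith) h0
    have h3 : - l * #(Q f ∩ Q f') ≤ 3 * N := mul_le_mul (by linarith) h1 h0 (by norm_num)
    split_ifs with h
    · subst h
      rw [charVec_adjMatrix_charVec_self G (hQc f hf), hQN f hf, abs_le]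
      constructor <;> nlinarith
    · have h4 := charVec_adjMatrix_charVec_le hG' (hQc f hf) (hQc f' hf') hN (hQN f hf)
        (hQN f' hf') (by rwa [hQf f hf, hQf f' hf'])
      have h5 : 0 ≤ charVec (Q f) ⬝ᵥ G.adjMatrix ℝ *ᵥ charVec (Q f') := by
        rw [charVec_adjMatrix_charVec]
        exact Finset.sum_nonneg fun _ _ ↦ Nat.cast_nonneg _
      rw [abs_le]
      constructor <;> linarith

variable (G) in
/-- The Gram matrix counting common quasi-cliques. -/
noncomputable def quasiGram (N : ℕ) : Matrix V V ℝ :=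
  fun u v ↦ #{f ∈ quasiCliques G N | u ∈ f ∧ v ∈ f}

lemma quasiGram_form (N : ℕ) (x : V → ℝ) :
    x ⬝ᵥ quasiGram G N *ᵥ x = ∑ f ∈ quasiCliques G N, (∑ v ∈ f, x v) ^ 2 := by
  have h1 : ∀ u v, quasiGram G N u v =
      ∑ f ∈ quasiCliques G N, charVec f u * charVec f v := by
    intro u v
    simp only [quasiGram, charVec]
    rw [Finset.card_filter, Nat.cast_sum]
    refine Finset.sum_congr rfl fun f _ ↦ ?_
    by_cases hu : u ∈ f <;> by_cases hv : v ∈ f <;> simp [hu, hv]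
  have h2 : ∀ f ∈ quasiCliques G N, (∑ v ∈ f, x v) ^ 2 =
      ∑ u, ∑ v, x u * (charVec f u * charVec f v * x v) := by
    intro f _
    rw [← dotProduct_charVec, dotProduct, sq, Finset.sum_mul_sum]
    exact Finset.sum_congr rfl fun u _ ↦ Finset.sum_congr rfl fun v _ ↦ by ring
  rw [Finset.sum_congr rfl h2, Finset.sum_comm]
  simp only [dotProduct, mulVec, h1, Finset.mul_sum, Finset.sum_mul]
  refine Finset.sum_congr rfl fun u _ ↦ ?_
  rw [Finset.sum_comm]

lemma card_quasiCliques_mem_le {l : ℝ} (hl : -5 / 2 ≤ l) (hl0 : l ≤ 0)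
    (hG : ∀ y : V → ℝ, l * (y ⬝ᵥ y) ≤ y ⬝ᵥ G.adjMatrix ℝ *ᵥ y) {N : ℕ} (hN : 10000 ≤ N)
    (v : V) : #{f ∈ quasiCliques G N | v ∈ f} ≤ 2 := by
  by_contra! h
  obtain ⟨H, hH, hH3⟩ := Finset.exists_subset_card_eq (show 3 ≤ _ from h)
  have h1 := quadratic_form_ge_sum_sq hl hl0 hG (by omega) (hH.trans (filter_subset _ _))
    (by omega) (charVec {v})
  have h2 : ∀ f ∈ H, (∑ u ∈ f, charVec {v} u) ^ 2 = 1 := by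
    intro f hf
    have := (mem_filter.mp (hH hf)).2
    simp [charVec, this]
  have h3 : ∑ u, |charVec {v} u| = 1 := by
    simp [charVec, apply_ite]
  rw [Finset.sum_congr rfl h2, h3, charVec_dotProduct_charVec,
    charVec_adjMatrix_charVec_of_forall_not_adj G (by simp)] at h1
  simp only [inter_self, card_singleton, sum_const, hH3] at h1
  have hN' : (10000 : ℝ) ≤ N := by exact_mod_cast hN
  have h4 : 4800 * (1 : ℝ) ^ 2 / N ≤ 48 / 100 := by
    rw [div_le_iff₀ (by linarith)]; linarith
  norm_num at h1 h4
  linarith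

lemma smallMinorsGE_sub_quasiGram {l : ℝ} (hl : -5 / 2 ≤ l) (hl0 : l ≤ 0)
    (hG : ∀ y : V → ℝ, l * (y ⬝ᵥ y) ≤ y ⬝ᵥ G.adjMatrix ℝ *ᵥ y) {N : ℕ} (hN : 10000 ≤ N) :
    SmallMinorsGE (G.adjMatrix ℝ - quasiGram G N) (l - 19200 / N) := by
  intro r g t hr hg
  set x : V → ℝ := fun v ↦ ∑ i, if g i = v then t i else 0 with hx
  have hN0 : (0 : ℝ) < N := by exact_mod_cast (show 0 < N by omega)
  -- sums over `V` weighted by `x` are sums over the four chosen vertices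
  have hsum : ∀ φ : V → ℝ, ∑ v, x v * φ v = ∑ i, t i * φ (g i) := by
    intro φ
    simp only [hx, Finset.sum_mul]
    rw [Finset.sum_comm]
    simp
  have hxg : ∀ i, x (g i) = t i := by
    intro i
    simp only [hx]
    rw [Finset.sum_eq_single i]
    · simp
    · intro j _ hj
      rw [if_neg (fun h ↦ hj (hg h))]
    · simp
  have hxx : x ⬝ᵥ x = ∑ i, t i ^ 2 := by
    rw [dotProduct, hsum]
    exact Finset.sum_congr rfl fun i _ ↦ by rw [hxg, sq]
  have hform : ∀ M : Matrix V V ℝ,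
      x ⬝ᵥ M *ᵥ x = ∑ i, ∑ j, t i * t j * M (g i) (g j) := by
    intro M
    rw [dotProduct, hsum]
    refine Finset.sum_congr rfl fun i _ ↦ ?_
    rw [mulVec, dotProduct_comm, dotProduct, hsum, Finset.mul_sum]
    exact Finset.sum_congr rfl fun j _ ↦ by ring
  have hX : (∑ v, |x v|) ^ 2 ≤ 4 * ∑ i, t i ^ 2 := by
    have h1 : ∑ v, |x v| ≤ ∑ i, |t i| := by
      calc ∑ v, |x v| ≤ ∑ v, ∑ i, |if g i = v then t i else 0| :=
            Finset.sum_le_sum fun v _ ↦ Finset.abs_sum_le_sum_abs _ _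
        _ = ∑ i, |t i| := by
            rw [Finset.sum_comm]
            simp [apply_ite]
    have h2 : (∑ i, |t i|) ^ 2 ≤ r * ∑ i, |t i| ^ 2 := by
      simpa using sq_sum_le_card_mul_sum_sq (s := univ) (f := fun i ↦ |t i|)
    have h3 : (r : ℝ) ≤ 4 := by exact_mod_cast hr
    simp only [sq_abs] at h2
    calc (∑ v, |x v|) ^ 2 ≤ (∑ i, |t i|) ^ 2 :=
          pow_le_pow_left₀ (Finset.sum_nonneg fun v _ ↦ abs_nonneg _) h1 2
      _ ≤ r * ∑ i, t i ^ 2 := h2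
      _ ≤ 4 * ∑ i, t i ^ 2 :=
          mul_le_mul_of_nonneg_right h3 (Finset.sum_nonneg fun i _ ↦ sq_nonneg _)
  set H : Finset (Finset V) := univ.biUnion fun i ↦ {f ∈ quasiCliques G N | g i ∈ f} with hH
  have hHc : #H ≤ 8 := by
    have := Finset.card_biUnion_le_card_mul univ
      (fun i ↦ ({f ∈ quasiCliques G N | g i ∈ f} : Finset (Finset V))) 2
      fun i _ ↦ card_quasiCliques_mem_le hl hl0 hG hN (g i)
    rw [card_univ, Fintype.card_fin] at this
    rw [hH]
    omega
  have hHs : H ⊆ quasiCliques G N := by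
    rw [hH, biUnion_subset]
    exact fun i _ ↦ filter_subset _ _
  have h1 := quadratic_form_ge_sum_sq hl hl0 hG (by omega) hHs hHc x
  have h2 : ∑ f ∈ H, (∑ v ∈ f, x v) ^ 2 = x ⬝ᵥ quasiGram G N *ᵥ x := by
    rw [quasiGram_form]
    refine Finset.sum_subset hHs fun f hf hfH ↦ ?_
    rw [← dotProduct_charVec, dotProduct, hsum, Finset.sum_eq_zero, zero_pow two_ne_zero]
    intro i _
    have : g i ∉ f := fun h ↦ hfH (mem_biUnion.mpr ⟨i, mem_univ _, mem_filter.mpr ⟨hf, h⟩⟩)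
    simp [charVec, this]
  have h3 : 4800 * (∑ v, |x v|) ^ 2 / N ≤ 19200 / N * ∑ i, t i ^ 2 := by
    rw [div_mul_eq_mul_div]
    refine div_le_div_of_nonneg_right ?_ hN0.le
    linarith
  rw [← hform, sub_mulVec, dotProduct_sub, ← h2, ← hxx]
  rw [← hxx] at h3
  linarith

/-- A graph of large minimum degree with smallest eigenvalue bounded away from `α` from above has
smallest eigenvalue at least `-1 - √2`. -/
lemma neg_one_sub_sqrt_two_le_lambdaMin [Nonempty V] {α ε : ℝ}
    (hα : IsLeast {x : ℝ | x ^ 3 + 2 * x ^ 2 - 2 * x - 2 = 0} α) (hε : 0 < ε) {N : ℕ}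
    (hN : 10000 ≤ N) (hNε : 19200 / N < ε) (hdeg : ∀ v, 2 ^ (7 + N) ≤ G.degree v)
    (hmin : α + ε ≤ lambdaMin G) : -1 - Real.sqrt 2 ≤ lambdaMin G := by
  by_contra! hlt
  obtain ⟨hα1, hα2⟩ := cubic_root_bounds hα
  have hG := lambdaMin_mul_dotProduct_self_le G
  have hsq := Real.sqrt_nonneg 2
  have hl : -5 / 2 ≤ lambdaMin G := by linarith
  have hG' : ∀ y : V → ℝ, -5 / 2 * (y ⬝ᵥ y) ≤ y ⬝ᵥ G.adjMatrix ℝ *ᵥ y := fun y ↦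
    (mul_le_mul_of_nonneg_right hl (by simpa using dotProduct_star_self_nonneg y)).trans (hG y)
  have hsm := smallMinorsGE_sub_quasiGram hl (by linarith) hG hN
  have hS : (G.adjMatrix ℝ - quasiGram G N).IsSymm := by
    ext u v
    simp [quasiGram, SimpleGraph.adj_comm, and_comm]
  have hcon : -1 - Real.sqrt 2 ≤ lambdaMin G := by
    refine le_lambdaMin G fun x ↦ ?_
    have h1 := mul_dotProduct_self_le_of_forall_eigenvalue_ge
      (M := G.adjMatrix ℝ - quasiGram G N) (c := -1 - Real.sqrt 2)
      (by rwa [Matrix.IsHermitian, Matrix.conjTranspose_eq_transpose_of_trivial])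
      (fun μ y hy0 hy ↦ hsm.neg_one_sub_sqrt_two_le hS hα (by linarith) ?_ ?_ hy0 hy) x
    · rw [sub_mulVec, dotProduct_sub, quasiGram_form] at h1
      have h2 : 0 ≤ ∑ f ∈ quasiCliques G N, (∑ v ∈ f, x v) ^ 2 :=
        Finset.sum_nonneg fun f _ ↦ sq_nonneg _
      linarith
    · intro u v
      refine ⟨(if G.Adj u v then 1 else 0) - #{f ∈ quasiCliques G N | u ∈ f ∧ v ∈ f}, ?_⟩
      simp [quasiGram, SimpleGraph.adjMatrix_apply]
    · intro v
      obtain ⟨f, hf, hvf⟩ := exists_mem_quasiCliques hG' (hdeg v)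
      have h3 : 0 < #{f ∈ quasiCliques G N | v ∈ f ∧ v ∈ f} :=
        Finset.card_pos.mpr ⟨f, mem_filter.mpr ⟨hf, hvf, hvf⟩⟩
      have h4 : (1 : ℝ) ≤ #{f ∈ quasiCliques G N | v ∈ f ∧ v ∈ f} := by exact_mod_cast h3
      rw [Matrix.sub_apply, SimpleGraph.adjMatrix_apply, if_neg G.irrefl, quasiGram]
      linarith
  exact absurd hcon (not_le.mpr hlt)

end Cliques

/-- The paw with a clique of order `n + 1` attached at each of its four vertices: `(i, 0)` are the
vertices of the paw. -/
def pawOfCliques (n : ℕ) : SimpleGraph (Fin 4 × Fin (n + 1)) where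
  Adj p q := p.1 = q.1 ∧ p.2 ≠ q.2 ∨
    p.2 = 0 ∧ q.2 = 0 ∧ p.1 ≠ q.1 ∧ (p.1 = 0 ∨ q.1 = 0 ∨ (2 ≤ p.1 ∧ 2 ≤ q.1))
  symm := ⟨by
    rintro p q (⟨h1, h2⟩ | ⟨h1, h2, h3, h4⟩)
    · exact Or.inl ⟨h1.symm, h2.symm⟩
    · exact Or.inr ⟨h2, h1, h3.symm, by tauto⟩⟩
  loopless := ⟨by
    rintro p (⟨_, h2⟩ | ⟨_, _, h3, _⟩)
    · exact h2 rfl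
    · exact h3 rfl⟩

lemma pawOfCliques_adj {n : ℕ} {p q : Fin 4 × Fin (n + 1)} : (pawOfCliques n).Adj p q ↔
    p.1 = q.1 ∧ p.2 ≠ q.2 ∨
      p.2 = 0 ∧ q.2 = 0 ∧ p.1 ≠ q.1 ∧ (p.1 = 0 ∨ q.1 = 0 ∨ (2 ≤ p.1 ∧ 2 ≤ q.1)) :=
  Iff.rfl

lemma pawOfCliques_connected (n : ℕ) : (pawOfCliques n).Connected := by
  rw [SimpleGraph.connected_iff_exists_forall_reachable]
  refine ⟨(0, 0), fun ⟨i, a⟩ ↦ ?_⟩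
  have h1 : (pawOfCliques n).Reachable (0, 0) (i, 0) := by
    by_cases hi : i = 0
    · rw [hi]
    · exact (pawOfCliques_adj.mpr (Or.inr ⟨rfl, rfl, Ne.symm hi, Or.inl rfl⟩)).reachable
  have h2 : (pawOfCliques n).Reachable (i, 0) (i, a) := by
    by_cases ha : a = 0
    · rw [ha]
    · exact ((pawOfCliques_adj (p := (i, 0)) (q := (i, a))).mpr
        (Or.inl ⟨rfl, Ne.symm ha⟩)).reachable
  exact h1.trans h2

lemma le_degree_pawOfCliques (n : ℕ) (p : Fin 4 × Fin (n + 1)) :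
    n ≤ (pawOfCliques n).degree p := by
  have h : (univ.erase p.2).image (fun b ↦ (p.1, b)) ⊆ (pawOfCliques n).neighborFinset p := by
    intro q hq
    simp only [mem_image, mem_erase, mem_univ, and_true] at hq
    obtain ⟨b, hb, rfl⟩ := hq
    rw [SimpleGraph.mem_neighborFinset]
    exact Or.inl ⟨rfl, hb.symm⟩
  have h1 := card_le_card h
  rw [card_image_of_injective _ fun b c h ↦ congrArg Prod.snd h, card_erase_of_mem (mem_univ _),
    card_univ, Fintype.card_fin] at h1
  rw [SimpleGraph.card_neighborFinset_eq_degree] at h1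
  simpa using h1

lemma pawOfCliques_form (n : ℕ) (y : Fin 4 × Fin (n + 1) → ℝ) :
    y ⬝ᵥ (pawOfCliques n).adjMatrix ℝ *ᵥ y = ∑ i, (∑ a, y (i, a)) ^ 2 - y ⬝ᵥ y +
      2 * (y (0, 0) * y (1, 0) + y (0, 0) * y (2, 0) + y (0, 0) * y (3, 0) +
        y (2, 0) * y (3, 0)) := by
  have hd : ∀ i, ∑ a, ∑ b, (if (pawOfCliques n).Adj (i, a) (i, b) then y (i, a) * y (i, b) else 0) =
      (∑ a, y (i, a)) ^ 2 - ∑ a, y (i, a) * y (i, a) := by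
    intro i
    rw [sq, Finset.sum_mul_sum, ← Finset.sum_sub_distrib]
    refine Finset.sum_congr rfl fun a _ ↦ ?_
    rw [eq_sub_iff_add_eq]
    have : y (i, a) * y (i, a) = ∑ b, if a = b then y (i, a) * y (i, b) else 0 := by simp
    rw [this, ← Finset.sum_add_distrib]
    refine Finset.sum_congr rfl fun b _ ↦ ?_
    by_cases hab : a = b <;> simp [pawOfCliques_adj, hab]
  have ho : ∀ i j, i ≠ j →
      ∑ a, ∑ b, (if (pawOfCliques n).Adj (i, a) (j, b) then y (i, a) * y (j, b) else 0) =
      if i = 0 ∨ j = 0 ∨ (2 ≤ i ∧ 2 ≤ j) then y (i, 0) * y (j, 0) else 0 := by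
    intro i j hij
    rw [Finset.sum_eq_single 0, Finset.sum_eq_single 0]
    · simp [pawOfCliques_adj, hij]
    · intro b _ hb; simp [pawOfCliques_adj, hij, hb]
    · simp
    · intro a _ ha; simp [pawOfCliques_adj, hij, ha]
    · simp
  have hs : ∀ i j : Fin 4, ∑ a, ∑ b,
      (if (pawOfCliques n).Adj (i, a) (j, b) then y (i, a) * y (j, b) else 0) =
      if i = j then (∑ a, y (i, a)) ^ 2 - ∑ a, y (i, a) * y (i, a) else
        if i = 0 ∨ j = 0 ∨ (2 ≤ i ∧ 2 ≤ j) then y (i, 0) * y (j, 0) else 0 := by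
    intro i j
    split_ifs with h1 h2
    · rw [← h1, hd]
    · rw [ho i j h1, if_pos h2]
    · rw [ho i j h1, if_neg h2]
  have he : y ⬝ᵥ (pawOfCliques n).adjMatrix ℝ *ᵥ y = ∑ i, ∑ j, ∑ a, ∑ b,
      (if (pawOfCliques n).Adj (i, a) (j, b) then y (i, a) * y (j, b) else 0) := by
    rw [dotProduct_adjMatrix_mulVec]
    simp only [Fintype.sum_prod_type]
    exact Finset.sum_congr rfl fun i _ ↦ Finset.sum_comm
  rw [he]
  simp only [hs, dotProduct, Fintype.sum_prod_type, Fin.sum_univ_four]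
  simp
  ring

lemma paw_form_ge {α : ℝ} (hα : α ^ 3 + 2 * α ^ 2 - 2 * α - 2 = 0) (h1 : α < -2)
    (u v w z : ℝ) : (α + 1) * (u ^ 2 + v ^ 2 + w ^ 2 + z ^ 2) ≤
      2 * (u * v + u * w + u * z + w * z) := by
  obtain ⟨s, rfl⟩ : ∃ s, α = -1 - s := ⟨-1 - α, by ring⟩
  have hs : 1 < s := by linarith
  have hs3 : s ^ 3 + s ^ 2 - 3 * s - 1 = 0 := by linear_combination -hα
  have hid : 2 * (u * v + u * w + u * z + w * z) + s * (u ^ 2 + v ^ 2 + w ^ 2 + z ^ 2) =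
      s * (v + u / s) ^ 2 + (s + 1) / 2 * (w + z + 2 * u / (s + 1)) ^ 2 +
        (s - 1) / 2 * (w - z) ^ 2 := by
    have h2 : s ≠ 0 := by linarith
    have h3 : s + 1 ≠ 0 := by linarith
    field_simp
    linear_combination (2 * u ^ 2) * hs3
  have h4 : 0 ≤ s * (v + u / s) ^ 2 + (s + 1) / 2 * (w + z + 2 * u / (s + 1)) ^ 2 +
        (s - 1) / 2 * (w - z) ^ 2 := by
    have : 0 ≤ s - 1 := by linarith
    positivity
  linarith

lemma le_lambdaMin_pawOfCliques {α : ℝ} (hα : α ^ 3 + 2 * α ^ 2 - 2 * α - 2 = 0) (h1 : α < -2)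
    (n : ℕ) : α ≤ lambdaMin (pawOfCliques n) := by
  refine le_lambdaMin _ fun y ↦ ?_
  rw [pawOfCliques_form]
  have h2 := paw_form_ge hα h1 (y (0, 0)) (y (1, 0)) (y (2, 0)) (y (3, 0))
  have h3 : y (0, 0) ^ 2 + y (1, 0) ^ 2 + y (2, 0) ^ 2 + y (3, 0) ^ 2 ≤ y ⬝ᵥ y := by
    have h4 : ∀ i, y (i, 0) ^ 2 ≤ ∑ a, y (i, a) * y (i, a) := fun i ↦ by
      rw [sq]
      exact Finset.single_le_sum (f := fun a ↦ y (i, a) * y (i, a))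
        (fun a _ ↦ mul_self_nonneg _) (mem_univ 0)
    rw [dotProduct, Fintype.sum_prod_type, Fin.sum_univ_four]
    linarith [h4 0, h4 1, h4 2, h4 3]
  have h5 : 0 ≤ ∑ i, (∑ a, y (i, a)) ^ 2 := Finset.sum_nonneg fun i _ ↦ sq_nonneg _
  nlinarith

lemma lambdaMin_pawOfCliques_lt {n : ℕ} (hn : 100 ≤ n) :
    lambdaMin (pawOfCliques n) < -1 - Real.sqrt 2 := by
  have hs : Real.sqrt 2 < 142 / 100 := by
    rw [Real.sqrt_lt' (by norm_num)]; norm_num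
  have hn0 : (100 : ℝ) ≤ n := by exact_mod_cast hn
  set c : Fin 4 → ℝ := ![15, -10, -6, -6] with hc
  set y : Fin 4 × Fin (n + 1) → ℝ := fun p ↦ if p.2 = 0 then c p.1 else - c p.1 / n with hy
  have h := lambdaMin_mul_dotProduct_self_le (pawOfCliques n) y
  have h1 : ∀ i, ∑ a, y (i, a) = 0 := by
    intro i
    rw [Fin.sum_univ_succ]
    simp only [hy, if_true, Fin.succ_ne_zero, if_false, sum_const, card_univ, Fintype.card_fin,
      nsmul_eq_mul]
    field_simp
    ring
  have h2 : ∀ i, ∑ a, y (i, a) * y (i, a) = c i ^ 2 * (1 + 1 / n) := by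
    intro i
    rw [Fin.sum_univ_succ]
    simp only [hy, if_true, Fin.succ_ne_zero, if_false, sum_const, card_univ, Fintype.card_fin,
      nsmul_eq_mul]
    field_simp
  have h3 : y ⬝ᵥ y = 397 * (1 + 1 / n) := by
    rw [dotProduct, Fintype.sum_prod_type, Fin.sum_univ_four, h2, h2, h2, h2]
    simp [hc]
    ring
  have h0 : ∑ i, (∑ a, y (i, a)) ^ 2 = 0 := Finset.sum_eq_zero fun i _ ↦ by rw [h1]; ring
  have hy0 : y (0, 0) = 15 := by simp [hy, hc]
  have hy1 : y (1, 0) = -10 := by simp [hy, hc]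
  have hy2 : y (2, 0) = -6 := by simp [hy, hc]
  have hy3 : y (3, 0) = -6 := by simp [hy, hc]
  rw [pawOfCliques_form, h3, h0, hy0, hy1, hy2, hy3] at h
  have h4 : 0 < 1 / (n : ℝ) := by positivity
  have h5 : 1 / (n : ℝ) ≤ 1 / 100 := one_div_le_one_div_of_le (by norm_num) hn0
  by_contra! hge
  have h6 : (-242 / 100) * (397 * (1 + 1 / (n : ℝ))) ≤
      lambdaMin (pawOfCliques n) * (397 * (1 + 1 / (n : ℝ))) :=
    mul_le_mul_of_nonneg_right (by linarith) (by positivity)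
  linarith

lemma exists_iso_fin {V : Type} [Fintype V] (H : SimpleGraph V) {k : ℕ} (hc : H.Connected)
    (hk : ∀ v, k ≤ H.degree v) : ∃ (n : ℕ) (G : SimpleGraph (Fin n)), G.Connected ∧
      (∀ v : Fin n, k ≤ G.degree v) ∧ lambdaMin G = lambdaMin H := by
  have := hc.nonempty
  obtain ⟨n, ⟨e⟩⟩ : ∃ n, Nonempty (V ≃ Fin n) := ⟨_, ⟨Fintype.equivFin V⟩⟩
  obtain ⟨G, ⟨iso⟩⟩ : ∃ G : SimpleGraph (Fin n), Nonempty (H ≃g G) := ⟨_, ⟨Iso.map e H⟩⟩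
  refine ⟨n, G, iso.connected_iff.mp hc, fun v ↦ ?_, (lambdaMin_eq_of_iso iso).symm⟩
  obtain ⟨p, rfl⟩ := iso.surjective v
  have h : G.degree (iso p) = H.degree p := by convert iso.degree_eq p
  exact (hk p).trans h.ge

/-- For every `k` some connected graph of minimum degree at least `k` has smallest eigenvalue in
`[α, -1 - √2)`. -/
lemma exists_fin_graph_ge {α : ℝ} (hα : IsLeast {x : ℝ | x ^ 3 + 2 * x ^ 2 - 2 * x - 2 = 0} α)
    (k : ℕ) : ∃ (n : ℕ) (G : SimpleGraph (Fin n)), G.Connected ∧ (∀ v : Fin n, k ≤ G.degree v) ∧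
      lambdaMin G < -1 - Real.sqrt 2 ∧ α ≤ lambdaMin G := by
  obtain ⟨n, G, hc, hk, heq⟩ := exists_iso_fin (pawOfCliques (k + 100)) (k := k)
    (pawOfCliques_connected _) fun p ↦
      (Nat.le_add_right k 100).trans (le_degree_pawOfCliques (k + 100) p)
  refine ⟨n, G, hc, hk, heq ▸ lambdaMin_pawOfCliques_lt (by omega), heq ▸ ?_⟩
  have := (cubic_root_bounds hα).2
  exact le_lambdaMin_pawOfCliques hα.1 (by linarith) _

/-- `σ̂_k`, the supremum of `λmin` over connected graphs with minimum degree at least `k` and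
`λmin < -1-√2`, is nonincreasing in `k` (for `k ≥ 1`) and tends to `α₁`, the smallest real
root of `x³+2x²-2x-2`, as `k → ∞`. -/
theorem stmt_6 (α₁ : ℝ) (hα₁ : IsLeast {x : ℝ | x ^ 3 + 2 * x ^ 2 - 2 * x - 2 = 0} α₁) :
    (∀ j k : ℕ, 1 ≤ j → j ≤ k →
      sSup {x : ℝ | ∃ (n : ℕ) (G : SimpleGraph (Fin n)), G.Connected ∧
          (∀ v : Fin n, k ≤ G.degree v) ∧ lambdaMin G < -1 - Real.sqrt 2 ∧ lambdaMin G = x} ≤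
      sSup {x : ℝ | ∃ (n : ℕ) (G : SimpleGraph (Fin n)), G.Connected ∧
          (∀ v : Fin n, j ≤ G.degree v) ∧ lambdaMin G < -1 - Real.sqrt 2 ∧ lambdaMin G = x}) ∧
    Tendsto (fun k : ℕ =>
        sSup {x : ℝ | ∃ (n : ℕ) (G : SimpleGraph (Fin n)), G.Connected ∧
          (∀ v : Fin n, k ≤ G.degree v) ∧ lambdaMin G < -1 - Real.sqrt 2 ∧ lambdaMin G = x})
      atTop (nhds α₁) := by
  set σ : ℕ → Set ℝ := fun k ↦ {x : ℝ | ∃ (n : ℕ) (G : SimpleGraph (Fin n)), G.Connected ∧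
    (∀ v : Fin n, k ≤ G.degree v) ∧ lambdaMin G < -1 - Real.sqrt 2 ∧ lambdaMin G = x} with hσ
  have hbdd : ∀ k, BddAbove (σ k) := fun k ↦
    ⟨-1 - Real.sqrt 2, by rintro x ⟨n, G, _, _, h, rfl⟩; exact h.le⟩
  have hmem : ∀ k, ∃ x ∈ σ k, α₁ ≤ x := fun k ↦ by
    obtain ⟨n, G, h1, h2, h3, h4⟩ := exists_fin_graph_ge hα₁ k
    exact ⟨_, ⟨n, G, h1, h2, h3, rfl⟩, h4⟩
  have hne : ∀ k, (σ k).Nonempty := fun k ↦ (hmem k).imp fun x hx ↦ hx.1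
  constructor
  · intro j k _ hjk
    refine csSup_le_csSup (hbdd j) (hne k) ?_
    rintro x ⟨n, G, h1, h2, h3⟩
    exact ⟨n, G, h1, fun v ↦ hjk.trans (h2 v), h3⟩
  · rw [Metric.tendsto_atTop]
    intro ε hε
    obtain ⟨m, hm⟩ := exists_nat_gt (19200 / (ε / 2))
    set N := max 10000 m
    have hN : 19200 / (N : ℝ) < ε / 2 := by
      have hmN : (m : ℝ) ≤ N := by exact_mod_cast le_max_right _ _
      rw [div_lt_comm₀ (lt_of_lt_of_le ((by positivity : (0 : ℝ) < _).trans hm) hmN)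
        (by positivity)]
      exact hm.trans_le hmN
    refine ⟨2 ^ (7 + N), fun k hk ↦ ?_⟩
    have hlow : α₁ ≤ sSup (σ k) := by
      obtain ⟨x, hx, hxα⟩ := hmem k
      exact hxα.trans (le_csSup (hbdd k) hx)
    have hup : sSup (σ k) ≤ α₁ + ε / 2 := by
      refine csSup_le (hne k) ?_
      rintro x ⟨n, G, h1, h2, h3, rfl⟩
      by_contra! hlt
      have := h1.nonempty
      exact absurd h3 (not_lt.mpr (neg_one_sub_sqrt_two_le_lambdaMin hα₁ (half_pos hε)
        (le_max_left _ _) hN (fun v ↦ by convert hk.trans (h2 v)) hlt.le))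
    rw [Real.dist_eq, abs_lt]
    constructor <;> linarith
end

section
/- Let β be the smallest real root of the polynomial x⁶ − 3x⁵ − 7x⁴ + 21x³ + 13x² − 35x − 4 (β ≈ −2.0391). Then every connected 3-regular finite simple graph G with λmin(G) < −2 satisfies λmin(G) ≤ β, and there exists a connected 3-regular finite simple graph whose smallest adjacency eigenvalue equals β; hence the supremum of λmin over all connected 3-regular graphs with λmin < −2 equals β and is attained. -/
open SimpleGraph Filter

attribute [local instance] Classical.propDecidable

/-- The action of the adjacency operator of `G` on real functions. -/
noncomputable def nbrSum {V R : Type} [Fintype V] [AddCommMonoid R] (G : SimpleGraph V) (y : V → R)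
    (v : V) : R :=
  ∑ u, if G.Adj v u then y u else 0

section Spectral

variable {V : Type} [Fintype V] (G : SimpleGraph V)

lemma adjMatrix_mulVec_eq_nbrSum (y : V → ℝ) : (G.adjMatrix ℝ).mulVec y = nbrSum G y := by
  ext v
  simp [Matrix.mulVec, dotProduct, nbrSum, adjMatrix_apply]

lemma lambdaMin_mul_sum_sq_le (y : V → ℝ) :
    lambdaMin G * ∑ v, y v ^ 2 ≤ ∑ v, y v * nbrSum G y v := by
  set hA := adjMatrix_isHermitian G
  have hle : ∀ i, lambdaMin G ≤ hA.eigenvalues i := fun i =>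
    ciInf_le (Set.finite_range _).bddBelow i
  have hpsd : (G.adjMatrix ℝ - lambdaMin G • (1 : Matrix V V ℝ)).PosSemidef := by
    have h1 : G.adjMatrix ℝ - lambdaMin G • (1 : Matrix V V ℝ) =
        (hA.eigenvectorUnitary : Matrix V V ℝ) *
          Matrix.diagonal (fun i => hA.eigenvalues i - lambdaMin G) *
          (hA.eigenvectorUnitary : Matrix V V ℝ).conjTranspose := by
      have h2 : Matrix.diagonal (fun i => hA.eigenvalues i - lambdaMin G) =
          Matrix.diagonal (RCLike.ofReal ∘ hA.eigenvalues) - lambdaMin G • (1 : Matrix V V ℝ) := by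
        ext i j
        by_cases h : i = j <;> simp [h, Matrix.diagonal]
      have h3 : (hA.eigenvectorUnitary : Matrix V V ℝ) *
          (hA.eigenvectorUnitary : Matrix V V ℝ).conjTranspose = 1 :=
        Unitary.coe_mul_star_self hA.eigenvectorUnitary
      rw [h2, Matrix.mul_sub, Matrix.sub_mul]
      simp only [Matrix.mul_smul, Matrix.smul_mul, Matrix.mul_one, h3]
      congr 1
      exact hA.spectral_theorem
    rw [h1]
    refine Matrix.PosSemidef.mul_mul_conjTranspose_same ?_ _
    exact Matrix.PosSemidef.diagonal fun i => sub_nonneg.2 (hle i)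
  have h := hpsd.dotProduct_mulVec_nonneg y
  rw [Matrix.sub_mulVec, adjMatrix_mulVec_eq_nbrSum, Matrix.smul_mulVec, Matrix.one_mulVec] at h
  simp only [dotProduct, Pi.sub_apply, Pi.smul_apply, star_trivial, smul_eq_mul] at h
  rw [← sub_nonneg, Finset.mul_sum, ← Finset.sum_sub_distrib]
  exact h.trans_eq (Finset.sum_congr rfl fun _ _ => by ring)

lemma exists_eigenvector_lambdaMin [Nonempty V] :
    ∃ x : V → ℝ, x ≠ 0 ∧ ∀ v, nbrSum G x v = lambdaMin G * x v := by
  set hA := adjMatrix_isHermitian G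
  obtain ⟨i, hi⟩ : ∃ i, hA.eigenvalues i = lambdaMin G := exists_eq_ciInf_of_finite
  refine ⟨hA.eigenvectorBasis i, fun h => ?_, fun v => ?_⟩
  · exact hA.eigenvectorBasis.orthonormal.ne_zero i (by ext v; exact congrFun h v)
  · rw [← adjMatrix_mulVec_eq_nbrSum, hA.mulVec_eigenvectorBasis, hi]
    rfl

end Spectral

namespace CubicSearch

/-! ### Executable checks on encoded graphs

A graph on a list of vertices is encoded by its strict upper triangular adjacency matrix: the
`i`-th row lists the adjacency of the `i`-th vertex to the later ones. -/

/-- The sum of the entries of `v` selected by `r`. -/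
def dot : List Bool → List ℤ → ℤ
  | true :: r, a :: v => a + dot r v
  | false :: r, _ :: v => dot r v
  | _, _ => 0

/-- The adjacency matrix encoded by the first argument, applied to a vector. -/
def act : List (List Bool) → List ℤ → List ℤ
  | r :: st, a :: v => dot r v :: List.zipWith (fun b z => bif b then z + a else z) r (act st v)
  | _, _ => []

/-- The standard bilinear form on integer lists. -/
def inner (v w : List ℤ) : ℤ := (List.zipWith (· * ·) v w).sum

/-- Test whether an integer is negative. -/
def isNeg : ℤ → Bool
  | .ofNat _ => false
  | .negSucc _ => true

/-- Test whether an integer is zero. -/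
def isZero : ℤ → Bool
  | .ofNat n => Nat.beq n 0
  | .negSucc _ => false

/-- The quadratic form of `a + b A` is negative at `v`. -/
def cuts (a b : ℤ) (st : List (List Bool)) (v : List ℤ) : Bool :=
  Nat.beq v.length st.length && isNeg (b * inner v (act st v) + a * inner v v)

/-- The polynomial with the given coefficients (constant term first) in `A`, applied to `e`. -/
def polyAct (st : List (List Bool)) (e : List ℤ) : List ℤ → List ℤ
  | [] => e.map fun _ => 0
  | c :: cs => List.zipWith (fun a z => c * a + z) e (act st (polyAct st e cs))

/-- The coefficients of the sextic polynomial. -/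
def sextic : List ℤ := [-4, -35, 13, 21, -7, -3, 1]

/-- The upper triangle of the Schur complement of the pivot `p` with pivot row `r`, times `p`. -/
def schur (p : ℤ) : List ℤ → List (List ℤ) → List (List ℤ)
  | a :: r, row :: rows =>
    List.zipWith (fun m b => p * m - a * b) row (a :: r) :: schur p r rows
  | _, _ => []

/-- Test whether a symmetric matrix, given by its upper triangle, is positive semidefinite. -/
def psd : ℕ → List (List ℤ) → Bool
  | _, [] => true
  | k + 1, (p :: r) :: rows =>
    bif isZero p then r.all isZero && psd k rows else !isNeg p && psd k (schur p r rows)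
  | _, _ => false

/-- The upper triangle of `A + 2 + e eᵀ`. -/
def shifted : List (List Bool) → List ℤ → List (List ℤ)
  | r :: st, a :: e =>
    ((2 + a * a) :: List.zipWith (fun b c => bif b then 1 + a * c else a * c) r e) :: shifted st e
  | _, _ => []

/-- The degrees of the vertices. -/
def degrees (st : List (List Bool)) : List ℤ := act st (st.map fun _ => 1)

/-- The graph is cubic, `A + 2 + e eᵀ` is positive semidefinite, and the sextic polynomial in `A`
annihilates `e`. -/
def closes (st : List (List Bool)) (e : List ℤ) : Bool :=
  Nat.beq e.length st.length && (degrees st).all (fun d => isZero (d - 3)) &&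
    (polyAct st e sextic).all isZero && psd st.length (shifted st e)

/-- All possible adjacency rows of a new vertex, given the degrees of the old ones. -/
def rows : List ℤ → List (List Bool)
  | [] => [[]]
  | d :: ds => (rows ds).flatMap fun r =>
      bif isNeg (d - 3) then [false :: r, true :: r] else [false :: r]

/-- The rows of `rows` in which the `i`-th entry and at most three entries are selected. -/
def validRows (i : ℕ) (ds : List ℤ) : List (List Bool) :=
  (rows ds).filter fun r => r.getD i false && isNeg (dot r (ds.map fun _ => 1) - 4)

/-- Every element of the first list is related to the element of the second at the same place. -/
def allPaired {α γ : Type} (f : γ → α → Bool) : List α → List γ → Bool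
  | [], _ => true
  | a :: as, c :: cs => f c a && allPaired f as cs
  | _ :: _, [] => false

/-- A certificate for an induced subgraph of a cubic graph: a vector which is negative for
`104 + 51 A`, or a vector `e` for `closes`, or a vertex to be given a further neighbour together
with certificates for all resulting subgraphs. -/
inductive Cert
  | cut (v : List ℤ)
  | close (e : List ℤ)
  | grow (i : ℕ) (cs : List Cert)

/-- Verification of a certificate; the first argument bounds its depth. -/
def check : ℕ → Cert → List (List Bool) → Bool
  | k + 1, c, st => match c with
    | .cut v => cuts 104 51 st v
    | .close e => closes st e
    | .grow i cs => isNeg ((degrees st).getD i 3 - 3) &&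
        allPaired (fun c r => check k c (r :: st)) (validRows i (degrees st)) cs
  | 0, _, _ => false

/-! ### Soundness of the checks -/

lemma isNeg_iff {z : ℤ} : isNeg z = true ↔ z < 0 := by
  cases z with
  | ofNat n => simp [isNeg]
  | negSucc n => simp [isNeg, Int.negSucc_lt_zero]

lemma isZero_iff {z : ℤ} : isZero z = true ↔ z = 0 := by
  cases z with
  | ofNat n => simp [isZero]
  | negSucc n => simp [isZero]

section Soundness

variable {V : Type}

/-- The encoding of the subgraph of `G` induced on a list of vertices. -/
noncomputable def code (G : SimpleGraph V) : List V → List (List Bool)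
  | [] => []
  | w :: xs => xs.map (fun u => decide (G.Adj w u)) :: code G xs

/-- The sum of `f` over the neighbours of `x` in a list. -/
noncomputable def listSum (G : SimpleGraph V) (xs : List V) (f : V → ℤ) (x : V) : ℤ :=
  (xs.map fun u => if G.Adj x u then f u else 0).sum

/-- The upper triangle of the matrix of a function of two variables. -/
def tri (f : V → V → ℤ) : List V → List (List ℤ)
  | [] => []
  | w :: xs => (f w w :: xs.map (f w)) :: tri f xs

variable (G : SimpleGraph V) {xs : List V}

lemma length_code (xs : List V) : (code G xs).length = xs.length := by
  induction xs with
  | nil => rfl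
  | cons w xs ih => simp [code, ih]

lemma dot_map (p : V → Bool) (f : V → ℤ) (xs : List V) :
    dot (xs.map p) (xs.map f) = (xs.map fun u => if p u = true then f u else 0).sum := by
  induction xs with
  | nil => rfl
  | cons w xs ih => cases h : p w <;> simp [dot, h, ih]

lemma inner_map (f g : V → ℤ) (xs : List V) :
    inner (xs.map f) (xs.map g) = (xs.map fun u => f u * g u).sum := by
  simp [inner, List.zipWith_map, List.zipWith_self]

lemma act_code (f : V → ℤ) (xs : List V) :
    act (code G xs) (xs.map f) = xs.map (listSum G xs f) := by
  induction xs with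
  | nil => rfl
  | cons w xs ih =>
    simp only [code, List.map_cons, act, ih, dot_map, List.zipWith_map, List.zipWith_self,
      decide_eq_true_eq]
    congr 1
    · simp [listSum]
    · refine List.map_congr_left fun x _ => ?_
      by_cases h : G.Adj w x
      · simp [listSum, h, h.symm, add_comm]
      · have h' : ¬ G.Adj x w := fun h' => h h'.symm
        simp [listSum, h, h']

lemma map_const_code (xs : List V) : ((code G xs).map fun _ => (1 : ℤ)) = xs.map fun _ => 1 := by
  simp [List.map_const', length_code]

lemma degrees_code (xs : List V) :
    degrees (code G xs) = xs.map (listSum G xs fun _ => 1) := by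
  rw [degrees, map_const_code, act_code]

lemma exists_map_eq (hn : xs.Nodup) {v : List ℤ} (hl : v.length = xs.length) :
    ∃ f : V → ℤ, v = xs.map f ∧ ∀ u ∉ xs, f u = 0 := by
  refine ⟨fun u => v.getD (xs.idxOf u) 0, List.ext_getElem (by simp [hl]) fun i h1 h2 => ?_,
    fun u hu => ?_⟩
  · have h3 : i < xs.length := hl ▸ h1
    simp [hn.idxOf_getElem i h3, h1]
  · simp [List.idxOf_of_notMem hu, ← hl]

/-- The quadratic form attached to the upper triangle of a symmetric matrix. -/
def triForm (f : V → V → ℤ) (y : V → ℝ) : List V → ℝ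
  | [] => 0
  | w :: xs => f w w * y w ^ 2 + 2 * y w * (xs.map fun u => f w u * y u).sum + triForm f y xs

lemma schur_tri (p : ℤ) (g : V → ℤ) (f : V → V → ℤ) (xs : List V) :
    schur p (xs.map g) (tri f xs) = tri (fun u v => p * f u v - g u * g v) xs := by
  induction xs with
  | nil => rfl
  | cons w xs ih => simp [schur, tri, ih, List.zipWith_map, List.zipWith_self]

lemma triForm_schur (p : ℤ) (g : V → ℤ) (f : V → V → ℤ) (y : V → ℝ) (xs : List V) :
    triForm (fun u v => p * f u v - g u * g v) y xs =
      p * triForm f y xs - (xs.map fun u => g u * y u).sum ^ 2 := by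
  induction xs with
  | nil => simp [triForm]
  | cons w xs ih =>
    have h : (xs.map fun u => ((p * f w u - g w * g u : ℤ) : ℝ) * y u).sum =
        p * (xs.map fun u => f w u * y u).sum - g w * (xs.map fun u => g u * y u).sum := by
      rw [eq_sub_iff_add_eq, ← List.sum_map_mul_left, ← List.sum_map_mul_left, ← List.sum_map_add]
      congr 1
      refine List.map_congr_left fun x _ => ?_
      push_cast
      ring
    simp only [triForm, ih, List.map_cons, List.sum_cons, h]
    push_cast
    ring

lemma triForm_nonneg_of_psd (k : ℕ) (f : V → V → ℤ) (xs : List V) (h : psd k (tri f xs) = true)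
    (y : V → ℝ) : 0 ≤ triForm f y xs := by
  induction k generalizing f xs with
  | zero =>
    cases xs with
    | nil => exact le_rfl
    | cons w xs => simp [psd, tri] at h
  | succ k ih =>
    cases xs with
    | nil => exact le_rfl
    | cons w xs =>
      simp only [tri, psd, Bool.cond_eq_ite] at h
      split_ifs at h with h0
      · rw [isZero_iff] at h0
        simp only [Bool.and_eq_true, List.all_eq_true, List.mem_map, forall_exists_index, and_imp,
          forall_apply_eq_imp_iff₂, isZero_iff] at h
        have h1 : (xs.map fun u => (f w u : ℝ) * y u) = xs.map fun _ => 0 :=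
          List.map_congr_left fun u hu => by simp [h.1 u hu]
        simpa [triForm, h0, h1] using ih f xs h.2
      · rw [isZero_iff] at h0
        simp only [Bool.and_eq_true, Bool.not_eq_true', ← Bool.not_eq_true, isNeg_iff, not_lt,
          schur_tri] at h
        have h2 := ih _ xs h.2
        rw [triForm_schur] at h2
        have hp : (0 : ℝ) < f w w := by exact_mod_cast lt_of_le_of_ne h.1 (Ne.symm h0)
        simp only [triForm]
        refine nonneg_of_mul_nonneg_right (a := (f w w : ℝ)) ?_ hp
        nlinarith [sq_nonneg (f w w * y w + (xs.map fun u => (f w u : ℝ) * y u).sum)]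

lemma triForm_eq_sum (f : V → V → ℤ) (hf : ∀ u v, f u v = f v u) (y : V → ℝ) (xs : List V) :
    triForm f y xs = (xs.map fun u => (xs.map fun v => f u v * y v * y u).sum).sum := by
  induction xs with
  | nil => rfl
  | cons w xs ih =>
    have h : (xs.map fun u => (f u w : ℝ) * y w * y u).sum =
        y w * (xs.map fun u => f w u * y u).sum := by
      rw [← List.sum_map_mul_left]
      congr 1
      exact List.map_congr_left fun u _ => by rw [hf]; ring
    have h' : (xs.map fun u => (f w u : ℝ) * y u * y w).sum =
        y w * (xs.map fun u => f w u * y u).sum := by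
      rw [← List.sum_map_mul_left]
      congr 1
      exact List.map_congr_left fun u _ => by ring
    simp only [triForm, ih, List.map_cons, List.sum_cons, List.sum_map_add, h, h']
    ring

lemma shifted_code (e : V → ℤ) (hn : xs.Nodup) :
    shifted (code G xs) (xs.map e) = tri (fun u v => (if u = v then 2 else 0) +
      (if G.Adj u v then 1 else 0) + e u * e v) xs := by
  induction xs with
  | nil => rfl
  | cons w xs ih =>
    rw [List.nodup_cons] at hn
    simp only [code, shifted, tri, List.map_cons, ih hn.2, List.zipWith_map, List.zipWith_self]
    congr 2
    · simp
    · refine List.map_congr_left fun u hu => ?_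
      have : w ≠ u := fun h => hn.1 (h ▸ hu)
      by_cases h : G.Adj w u <;> simp [h, this]

lemma listSum_eq_three_of_degrees
    (h : ((degrees (code G xs)).all fun d => isZero (d - 3)) = true) :
    ∀ v ∈ xs, listSum G xs (fun _ => 1) v = 3 := by
  simpa [degrees_code, isZero_iff, sub_eq_zero] using h

lemma mem_rows (d : V → ℤ) (p : V → Bool) (xs : List V)
    (h : ∀ u ∈ xs, p u = true → d u < 3) : xs.map p ∈ rows (xs.map d) := by
  induction xs with
  | nil => simp [rows]
  | cons w xs ih =>
    simp only [List.map_cons, rows, List.mem_flatMap]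
    refine ⟨_, ih fun u hu => h u (List.mem_cons_of_mem _ hu), ?_⟩
    have hw := h w List.mem_cons_self
    cases hp : p w
    · cases isNeg (d w - 3) <;> simp
    · have : isNeg (d w - 3) = true := isNeg_iff.2 (by have := hw hp; omega)
      simp [this]

lemma exists_of_allPaired {α γ : Type} {f : γ → α → Bool} {as : List α} {cs : List γ}
    (h : allPaired f as cs = true) {a : α} (ha : a ∈ as) : ∃ c, f c a = true := by
  induction as generalizing cs with
  | nil => simp at ha
  | cons b as ih =>
    cases cs with
    | nil => simp [allPaired] at h
    | cons c cs =>
      rw [allPaired, Bool.and_eq_true] at h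
      rcases List.mem_cons.1 ha with rfl | ha
      · exact ⟨c, h.1⟩
      · exact ih h.2 ha

variable [Fintype V]

lemma sum_map_eq_sum {M : Type} [AddCommMonoid M] (hn : xs.Nodup) {g : V → M}
    (h0 : ∀ u ∉ xs, g u = 0) : (xs.map g).sum = ∑ u, g u := by
  rw [← List.sum_toFinset g hn]
  exact Finset.sum_subset (Finset.subset_univ _) fun u _ hu => h0 u (by simpa using hu)

lemma listSum_eq_nbrSum (hn : xs.Nodup) {f : V → ℤ} (h0 : ∀ u ∉ xs, f u = 0) :
    listSum G xs f = nbrSum G f := by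
  ext x
  exact sum_map_eq_sum hn fun u hu => by simp [h0 u hu]

lemma nbrSum_intCast (f : V → ℤ) (v : V) : nbrSum G (fun u => (f u : ℝ)) v = nbrSum G f v := by
  simp [nbrSum]

lemma lambdaMin_lt_of_cuts (hn : xs.Nodup) {a b : ℤ} (hb : 0 < b) {v : List ℤ}
    (h : cuts a b (code G xs) v = true) : b * lambdaMin G < -a := by
  rw [cuts, Bool.and_eq_true, Nat.beq_eq, length_code] at h
  obtain ⟨hl, h⟩ := h
  obtain ⟨f, rfl, hf⟩ := exists_map_eq hn hl
  rw [isNeg_iff, act_code, inner_map, inner_map, listSum_eq_nbrSum G hn hf,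
    sum_map_eq_sum hn fun u hu => by simp [hf u hu],
    sum_map_eq_sum hn fun u hu => by simp [hf u hu]] at h
  have h1 := lambdaMin_mul_sum_sq_le G fun u => (f u : ℝ)
  simp only [nbrSum_intCast] at h1
  have h2 : (b : ℝ) * ∑ u, (f u : ℝ) * nbrSum G f u + a * ∑ u, (f u : ℝ) * f u < 0 := by
    exact_mod_cast h
  simp only [← sq] at h2
  have h3 : (0 : ℝ) ≤ ∑ u, (f u : ℝ) ^ 2 := Finset.sum_nonneg fun _ _ => sq_nonneg _
  have hb' : (0 : ℝ) < b := by exact_mod_cast hb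
  by_contra hcon
  push Not at hcon
  nlinarith [mul_le_mul_of_nonneg_left h1 hb'.le, mul_le_mul_of_nonneg_right hcon h3]

lemma nbrSum_comm (x g : V → ℝ) : ∑ v, x v * nbrSum G g v = ∑ v, nbrSum G x v * g v := by
  simp only [nbrSum, Finset.mul_sum, Finset.sum_mul]
  rw [Finset.sum_comm]
  refine Finset.sum_congr rfl fun u _ => Finset.sum_congr rfl fun v _ => ?_
  by_cases h : G.Adj v u
  · simp [h, h.symm]
  · have h' : ¬ G.Adj u v := fun h' => h h'.symm
    simp [h, h']

lemma sum_mul_polyAct (hn : xs.Nodup) (hx : ∀ u, u ∈ xs) {x : V → ℝ} {μ : ℝ}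
    (hμ : ∀ v, nbrSum G x v = μ * x v) (e : V → ℤ) (cs : List ℤ) :
    ∃ g : V → ℤ, polyAct (code G xs) (xs.map e) cs = xs.map g ∧
      ∑ u, x u * g u = cs.foldr (fun (c : ℤ) (t : ℝ) => (c : ℝ) + μ * t) 0 * ∑ u, x u * e u := by
  induction cs with
  | nil => exact ⟨fun _ => 0, by rw [polyAct, List.map_map]; rfl, by simp⟩
  | cons c cs ih =>
    obtain ⟨g, hg, hs⟩ := ih
    refine ⟨fun u => c * e u + nbrSum G g u, ?_, ?_⟩
    · rw [polyAct, hg, act_code, List.zipWith_map, List.zipWith_self,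
        listSum_eq_nbrSum G hn fun u hu => absurd (hx u) hu]
    · have h := nbrSum_comm G x fun u => g u
      simp only [nbrSum_intCast, hμ, mul_assoc, ← Finset.mul_sum, hs] at h
      simp only [Int.cast_add, Int.cast_mul, mul_add, Finset.sum_add_distrib, h, List.foldr_cons,
        add_mul, mul_left_comm _ (c : ℝ), ← Finset.mul_sum]
      ring

lemma listSum_le_three (hG : ∀ v, nbrSum G (fun _ => (1 : ℤ)) v = 3) (hn : xs.Nodup) (v : V) :
    listSum G xs (fun _ => 1) v ≤ 3 := by
  rw [← hG v, listSum, nbrSum, ← List.sum_toFinset _ hn]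
  exact Finset.sum_le_sum_of_subset_of_nonneg (Finset.subset_univ _) fun u _ _ => by
    split_ifs <;> simp

lemma mem_of_listSum_eq_three (hG : ∀ v, nbrSum G (fun _ => (1 : ℤ)) v = 3) (hn : xs.Nodup)
    {v w : V} (hv : listSum G xs (fun _ => 1) v = 3) (h : G.Adj v w) : w ∈ xs := by
  by_contra hw
  have := listSum_le_three G hG (List.nodup_cons.2 ⟨hw, hn⟩) v
  rw [listSum, List.map_cons, List.sum_cons, if_pos h] at this
  rw [listSum] at hv
  omega

lemma exists_adj_notMem (hG : ∀ v, nbrSum G (fun _ => (1 : ℤ)) v = 3) (hn : xs.Nodup)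
    {v : V} (hv : listSum G xs (fun _ => 1) v < 3) : ∃ w ∉ xs, G.Adj v w := by
  by_contra! hcon
  refine hv.ne (.trans ?_ (hG v))
  exact sum_map_eq_sum hn fun u hu => if_neg (hcon u hu)

/-- The conclusion reached from a verified certificate. -/
def Gap (μ : ℝ) : Prop :=
  51 * μ < -104 ∨ μ ^ 6 - 3 * μ ^ 5 - 7 * μ ^ 4 + 21 * μ ^ 3 + 13 * μ ^ 2 - 35 * μ - 4 = 0

lemma sextic_lambdaMin_of_closes (hG : ∀ v, nbrSum G (fun _ => (1 : ℤ)) v = 3) (hc : G.Connected)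
    (hμ : lambdaMin G < -2) (hn : xs.Nodup) (hne : xs ≠ []) {e : List ℤ}
    (h : closes (code G xs) e = true) :
    lambdaMin G ^ 6 - 3 * lambdaMin G ^ 5 - 7 * lambdaMin G ^ 4 + 21 * lambdaMin G ^ 3 +
      13 * lambdaMin G ^ 2 - 35 * lambdaMin G - 4 = 0 := by
  simp only [closes, Bool.and_eq_true, Nat.beq_eq, length_code] at h
  obtain ⟨⟨⟨hl, hdeg⟩, hpoly⟩, hpsd⟩ := h
  obtain ⟨e, rfl, -⟩ := exists_map_eq hn hl
  have hdeg' := listSum_eq_three_of_degrees G hdeg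
  have hall : ∀ u, u ∈ xs := by
    obtain ⟨v, hv⟩ := List.exists_mem_of_ne_nil xs hne
    intro u
    obtain ⟨p⟩ := hc.preconnected v u
    induction p with
    | nil => exact hv
    | cons hadj _ ih => exact ih (mem_of_listSum_eq_three G hG hn (hdeg' _ hv) hadj)
  have := hc.nonempty
  obtain ⟨x, hx0, hx⟩ := exists_eigenvector_lambdaMin G
  obtain ⟨g, hg, hs⟩ := sum_mul_polyAct G hn hall hx e sextic
  have hg0 : ∀ u, g u = 0 := by
    simpa [hg, isZero_iff, hall] using hpoly
  have hform := triForm_nonneg_of_psd _ _ _ (shifted_code G e hn ▸ hpsd) x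
  rw [triForm_eq_sum _ (fun u v => by simp only [G.adj_comm u v, eq_comm (a := u)]; ring),
    sum_map_eq_sum hn fun u hu => absurd (hall u) hu] at hform
  have hsum : ∀ u, (xs.map fun v => (((if u = v then 2 else 0) + (if G.Adj u v then 1 else 0) +
      e u * e v : ℤ) : ℝ) * x v * x u).sum =
      (2 + lambdaMin G) * x u ^ 2 + x u * e u * ∑ v, x v * e v := by
    intro u
    rw [sum_map_eq_sum hn fun u hu => absurd (hall u) hu]
    have h1 : x u * nbrSum G x u = ∑ v, (if G.Adj u v then 1 else 0) * x v * x u := by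
      rw [nbrSum, Finset.mul_sum]
      exact Finset.sum_congr rfl fun v _ => by split_ifs <;> ring
    have h2 : 2 * x u ^ 2 = ∑ v, (if u = v then 2 else 0) * x v * x u := by
      simp [ite_mul]
      ring
    have h3 : x u * e u * ∑ v, x v * e v = ∑ v, e u * e v * x v * x u := by
      rw [Finset.mul_sum]
      exact Finset.sum_congr rfl fun v _ => by ring
    rw [hx] at h1
    rw [h3, show (2 + lambdaMin G) * x u ^ 2 = 2 * x u ^ 2 + x u * (lambdaMin G * x u) by ring,
      h2, h1, ← Finset.sum_add_distrib, ← Finset.sum_add_distrib]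
    refine Finset.sum_congr rfl fun v _ => ?_
    push_cast
    ring
  simp only [hsum, Finset.sum_add_distrib, ← Finset.mul_sum, ← Finset.sum_mul] at hform
  have hpos : 0 < ∑ u, x u ^ 2 := by
    obtain ⟨u, hu⟩ := Function.ne_iff.1 hx0
    exact Finset.sum_pos' (fun _ _ => sq_nonneg _) ⟨u, Finset.mem_univ _, sq_pos_of_ne_zero hu⟩
  have hne0 : ∑ v, x v * e v ≠ 0 := by
    intro h0
    rw [h0] at hform
    nlinarith
  simp only [hg0, Int.cast_zero, mul_zero, Finset.sum_const_zero, sextic] at hs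
  have := (mul_eq_zero.1 hs.symm).resolve_right hne0
  simp only [List.foldr_cons, List.foldr_nil] at this
  push_cast at this
  linear_combination this

theorem gap_of_check (hG : ∀ v, nbrSum G (fun _ => (1 : ℤ)) v = 3) (hc : G.Connected)
    (hμ : lambdaMin G < -2) (k : ℕ) (c : Cert) (xs : List V) (hn : xs.Nodup) (hne : xs ≠ [])
    (h : check k c (code G xs) = true) : Gap (lambdaMin G) := by
  induction k generalizing c xs with
  | zero => simp [check] at h
  | succ k ih =>
    cases c with
    | cut v =>
      have := lambdaMin_lt_of_cuts G hn (by norm_num) h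
      exact Or.inl (by exact_mod_cast this)
    | close e => exact Or.inr (sextic_lambdaMin_of_closes G hG hc hμ hn hne h)
    | grow i cs =>
      rw [check, Bool.and_eq_true, isNeg_iff, degrees_code] at h
      obtain ⟨hdeg, hcs⟩ := h
      have hi : i < xs.length := by
        by_contra hi
        simp [List.getD, List.getElem?_eq_none (not_lt.1 hi)] at hdeg
      simp only [List.getD, List.getElem?_map, List.getElem?_eq_getElem hi, Option.map_some,
        Option.getD_some] at hdeg
      obtain ⟨w, hw, hadj⟩ := exists_adj_notMem G hG hn (by omega : listSum G xs _ xs[i] < 3)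
      have hle := listSum_le_three G hG hn w
      have hrow : (xs.map fun u => decide (G.Adj w u)) ∈
          validRows i (xs.map (listSum G xs fun _ => 1)) := by
        rw [validRows, List.mem_filter]
        refine ⟨mem_rows _ _ xs fun u hu hwu => ?_, ?_⟩
        · refine lt_of_le_of_ne (listSum_le_three G hG hn u) fun h3 => hw ?_
          exact mem_of_listSum_eq_three G hG hn h3 (of_decide_eq_true hwu).symm
        · have h1 : dot (xs.map fun u => decide (G.Adj w u)) (xs.map fun _ => 1) =
              listSum G xs (fun _ => 1) w := by
            rw [dot_map]
            simp [listSum]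
          rw [List.map_map, Bool.and_eq_true, isNeg_iff]
          refine ⟨by simpa [List.getD, hi] using hadj.symm, ?_⟩
          have h2 : dot (xs.map fun u => decide (G.Adj w u))
            (xs.map ((fun _ => 1) ∘ listSum G xs fun _ => 1)) = _ := h1
          omega
      obtain ⟨c, hc'⟩ := exists_of_allPaired hcs hrow
      exact ih c (w :: xs) (List.nodup_cons.2 ⟨hw, hn⟩) (by simp) hc'

end Soundness
/-- A certificate for the claw. -/
def clawCert : Cert :=
  .grow 0 [.grow 1 [.grow 0 [.cut [2, -4, -3, 6, 2, 2, -5], .cut [2, -2, -2, 2, 1, 1, -2], .grow 1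
    [.cut [1, 1, -3, -2, 4, 1, 1, -3], .cut [1, -1, -2, -2, 4, 2, 2, -4],
    .cut [1, 1, -2, -2, 2, 0, 1, -1], .cut [1, 0, -1, -2, 2, 1, 1, -2],
    .cut [2, 2, -2, 0, 1, -2, 0, 1], .grow 3 [.cut [2, 0, 0, -3, -4, 6, 2, 2, -5], .grow 4
    [.cut [2, 2, 1, 1, -3, -4, 5, 1, 1, -3], .cut [1, -1, 0, 0, -2, -2, 4, 2, 2, -4],
    .cut [2, 2, 1, 1, -1, -2, 1, -1, -2, 1], .close [0, 0, 0, 0, 0, 0, 0, 0, 0, 0]]],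
    .cut [1, 1, -1, -1, 1, -1, 0, 0], .grow 0 [.cut [1, -3, -2, 3, 1, -1, 2, 2, -1],
    .cut [2, -2, -2, 2, 0, -1, 1, 1, -1], .cut [1, -2, -1, 1, -1, 1, 1, 2, -2],
    .cut [1, -1, -1, 1, 0, 0, 1, 1, -1], .cut [2, -2, 0, 2, 1, -3, -2, 0, 2],
    .cut [2, -2, -1, 2, 1, -1, 0, 1, 0], .grow 2 [.cut [1, -1, -1, -2, 2, 1, -1, 2, 1, -1],
    .cut [2, 1, -2, -2, 1, -2, 1, 1, 2, -2], .cut [2, -2, 1, -2, 1, 2, -2, 1, -2, 1],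
    .close [0, 0, 0, 0, 0, 0, 0, 0, 0, 0]], .cut [1, -1, -1, 3, 2, -4, -1, -1, 3],
    .cut [2, -1, -2, 2, 1, -1, 1, 0, 0], .grow 2 [.cut [1, 0, -2, -3, 3, 0, -1, 2, 2, -1],
    .cut [2, 1, -1, -2, 1, -2, 1, 2, 1, -2], .cut [1, 0, -1, -1, 3, 2, -4, -1, -1, 3],
    .close [0, 0, 0, 0, 0, 0, 0, 0, 0, 0]], .cut [2, 0, 1, 0, 1, -1, -2, -1, 2]], .grow 5
    [.cut [1, 0, 1, 1, 1, -3, -3, -2, 4], .grow 0 [.cut [1, -3, 0, -2, 2, 2, -1, 3, 0, -1],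
    .cut [1, -1, 0, -1, -1, -1, 3, 3, 2, -4], .cut [2, -2, 1, -1, 1, 2, -2, 1, -2, 1],
    .close [0, 0, 0, 0, 0, 0, 0, 0, 0, 0]], .cut [2, 1, 1, 0, 0, -1, -2, -2, 2],
    .cut [2, 1, 1, -1, -1, 0, -2, -2, 2]], .cut [2, 1, -2, -2, 2, 0, -1, 0],
    .cut [1, 1, -1, 0, 0, -1, -1, 1]], .cut [2, -2, -2, 2, 0, 0, -1], .grow 1
    [.cut [1, 1, -3, -2, 4, 1, 1, -3], .cut [1, -1, -2, -2, 4, 2, 2, -4],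
    .cut [1, 1, -2, -2, 2, 1, 0, -1], .cut [1, 0, -1, -2, 2, 1, 1, -2], .grow 0
    [.cut [1, -3, -2, 3, 1, -1, 2, 2, -1], .cut [2, -2, -2, 2, 0, -1, 1, 1, -1],
    .cut [1, -2, -1, 1, -1, 1, 2, 1, -2], .cut [1, -1, -1, 1, 0, 0, 1, 1, -1],
    .cut [1, -1, -1, 3, 2, -4, -1, -1, 3], .cut [2, -1, -2, 2, 1, -1, 0, 1, 0], .grow 2
    [.cut [1, 0, -2, -3, 3, 0, -1, 2, 2, -1], .cut [2, 1, -1, -2, 1, -2, 1, 1, 2, -2],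
    .cut [1, 0, -1, -1, 3, 2, -4, -1, -1, 3], .close [0, 0, 0, 0, 0, 0, 0, 0, 0, 0]],
    .cut [2, -2, 0, 2, 1, -3, 0, -2, 2], .cut [2, -2, -1, 2, 1, -1, 1, 0, 0], .grow 2
    [.cut [1, -1, -1, -2, 2, 1, -1, 1, 2, -1], .cut [2, 1, -2, -2, 1, -2, 1, 2, 1, -2],
    .cut [2, -2, 1, -2, 1, 2, -2, -2, 1, 1], .close [0, 0, 0, 0, 0, 0, 0, 0, 0, 0]],
    .cut [2, 0, 1, 0, 1, -1, -1, -2, 2]], .grow 5 [.cut [1, 1, 0, 1, 1, -3, -3, -2, 4], .grow 0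
    [.cut [1, -3, -2, 0, 2, 2, -1, 3, 0, -1], .cut [1, -1, -1, 0, -1, -1, 3, 3, 2, -4],
    .cut [2, -2, -1, 1, 1, 2, -2, 1, -2, 1], .close [0, 0, 0, 0, 0, 0, 0, 0, 0, 0]],
    .cut [2, 1, 1, 0, 0, -1, -2, -2, 2], .cut [2, 1, 1, -1, -1, 0, -2, -2, 2]],
    .cut [2, 1, -2, -2, 2, -1, 0, 0], .cut [2, 2, -2, 0, 1, 0, -2, 1], .grow 3
    [.cut [2, 0, 0, -3, -4, 6, 2, 2, -5], .grow 4 [.cut [2, 2, 1, 1, -3, -4, 5, 1, 1, -3],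
    .cut [1, -1, 0, 0, -2, -2, 4, 2, 2, -4], .cut [2, 2, 1, 1, -1, -2, 1, -2, -1, 1],
    .close [0, 0, 0, 0, 0, 0, 0, 0, 0, 0]]], .cut [1, 1, -1, -1, 1, 0, -1, 0],
    .cut [1, 1, -1, 0, 0, -1, -1, 1]], .cut [2, -2, -2, 2, 0, 0, -1],
    .cut [2, 0, 0, -1, -2, -2, 2]], .grow 0 [.grow 4 [.grow 5
    [.cut [1, 1, -1, 1, 1, -3, -3, -2, 4], .grow 7 [.cut [1, 1, 1, -1, 1, 1, -3, -3, -3, 4],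
    .cut [3, 0, 3, -2, 3, 2, -7, -6, -6, 9], .cut [3, 3, 0, -2, 3, 2, -7, -6, -6, 9], .grow 8
    [.cut [1, 1, 0, 0, -1, 1, 1, -3, -2, -3, 4], .cut [1, 1, 0, 0, -1, 1, 0, -2, -1, -2, 2],
    .cut [2, 1, 0, 0, -1, 2, -1, -2, -1, -3, 3], .cut [2, 1, 0, 0, -2, 1, -1, -1, 0, -2, 1]],
    .cut [2, 1, 1, -2, 2, 0, -2, -2, -2, 3], .cut [2, -1, 1, -2, 1, 0, -2, -1, -2, 2],
    .cut [2, 1, -1, -2, 1, 0, -2, -1, -2, 2], .cut [2, 1, 1, -1, 3, 0, -4, -4, -4, 6], .grow 2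
    [.cut [1, -4, 2, -3, 1, -3, 2, 2, 2, 4, -4], .cut [2, -9, 5, -6, 2, -6, 5, 5, 5, 9, -9],
    .cut [2, 3, -1, 0, -1, 2, -2, -2, -1, -4, 3], .cut [2, 1, 0, -1, -1, 1, -1, -1, 0, -2, 1]],
    .grow 1 [.cut [1, -4, -3, 2, 1, -3, 2, 2, 2, 4, -4],
    .cut [2, -9, -6, 5, 2, -6, 5, 5, 5, 9, -9], .cut [2, 3, 0, -1, -1, 2, -2, -2, -1, -4, 3],
    .cut [2, 1, -1, 0, -1, 1, -1, -1, 0, -2, 1]], .cut [2, 0, 0, -2, 2, -1, -1, -1, -2, 1]],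
    .cut [1, 1, -1, 1, 0, -2, -2, -1, 2], .cut [2, 0, -2, 2, 0, -2, -2, -1, 3],
    .cut [2, 1, -1, 2, -1, -2, -3, -1, 3], .grow 7 [.cut [2, 1, 1, -1, 2, 0, -4, -4, -4, 6],
    .grow 0 [.cut [1, -2, -2, 1, 1, -2, 1, 2, 2, 3, -3],
    .cut [4, -7, -4, 4, -1, -2, 1, 4, 3, 7, -7], .cut [1, 1, 2, 1, -1, 2, 0, -4, -4, -4, 6],
    .cut [2, 0, 1, 1, -2, 2, 0, -2, -2, -2, 2]], .cut [2, 1, 1, -2, 2, 0, -2, -2, -2, 3],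
    .cut [2, 1, -1, -2, 2, -1, -1, -1, -2, 2]], .cut [2, 1, -2, 2, -1, -1, -2, -1, 1],
    .cut [1, 1, 0, 0, 0, -1, -2, -2, 2], .cut [2, 0, 0, 1, 0, -2, -2, -2, 2],
    .cut [1, 1, -1, 1, 0, -1, -1, -1, 2], .cut [2, 1, 0, 1, -1, -1, -2, -2, 2]],
    .cut [2, -2, 2, 0, -2, -2, -1, 2], .grow 5 [.cut [1, 2, -1, 2, -1, -2, -3, -1, 3], .grow 7
    [.cut [2, 1, 1, -1, 2, 0, -4, -4, -4, 6], .grow 0 [.cut [1, -2, 1, -2, 1, -2, 1, 2, 2, 3, -3],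
    .cut [4, -7, 4, -4, -1, -2, 1, 4, 3, 7, -7], .cut [1, 1, 1, 2, -1, 2, 0, -4, -4, -4, 6],
    .cut [2, 0, 1, 1, -2, 2, 0, -2, -2, -2, 2]], .cut [2, 1, 1, -2, 2, 0, -2, -2, -2, 3],
    .cut [2, -1, 1, -2, 2, -1, -1, -1, -2, 2]], .cut [1, 1, -1, 1, -1, -1, -2, -1, 2],
    .cut [2, 0, -2, 2, 0, -2, -2, -1, 2], .cut [2, 1, 0, 1, 0, -1, -2, -2, 2],
    .cut [2, 0, 0, 1, 1, -2, -2, -2, 2], .cut [1, 0, -1, 1, 0, -1, -1, -1, 1]],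
    .cut [2, -2, 2, -1, -1, -1, -1, 1], .cut [2, 0, 1, 0, -2, -2, -2, 2],
    .cut [1, -1, 1, 0, -1, -1, -1, 1], .cut [2, 0, 1, -1, -1, -2, -2, 2]], .grow 0
    [.cut [2, -4, 3, 3, -5, -2, -2, 5], .cut [1, -2, 1, 1, -2, -2, -1, 2],
    .cut [1, -2, 1, 1, -2, -1, -2, 2], .cut [2, -1, 1, 1, -1, -1, -1, 2]], .grow 4
    [.cut [2, 2, -1, 1, -2, -4, -2, 4], .grow 0 [.grow 7 [.cut [2, -1, 2, 0, 1, 1, -4, -4, -4, 6],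
    .cut [2, -2, 2, 0, 1, 1, -2, -2, -2, 3], .grow 0 [.cut [1, -2, 1, -2, 1, -2, 1, 2, 2, 3, -3],
    .cut [4, -7, -1, -2, 1, -4, 4, 3, 4, 7, -7], .cut [1, 1, -1, 2, 0, 2, 1, -4, -4, -4, 6],
    .cut [2, 0, -2, 2, 0, 1, 1, -2, -2, -2, 2]], .cut [2, -2, 2, -1, 1, -1, -1, -1, -2, 2]],
    .cut [2, -2, 0, 0, -2, 2, 2, 1, -2], .grow 0 [.cut [2, -4, 2, -3, 1, -2, 3, 3, 4, -5],
    .cut [2, -2, 1, -1, 1, -2, 1, 1, 2, -2], .grow 0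
    [.cut [1, -2, 0, -2, -1, -1, -1, 4, 4, 4, -6], .cut [2, -2, 0, -1, -1, 0, -2, 2, 2, 2, -2]],
    .close [0, 0, 0, 0, 0, 0, 0, 0, 0, 0]], .grow 7 [.cut [2, 3, -1, 1, 1, -1, -1, -1, -4, 3]]],
    .grow 0 [.cut [1, -3, -2, 0, 1, 1, 4, 1, -3], .cut [2, -2, -2, 1, 1, 0, 2, 0, -1], .grow 0
    [.cut [1, -3, 3, 0, 0, -2, 2, -1, 2, -1], .cut [2, -2, 1, -2, 1, -1, 1, 1, 2, -2],
    .cut [1, -1, 3, 2, 0, -1, -1, -4, -1, 3], .close [0, 0, 0, 0, 0, 0, 0, 0, 0, 0]],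
    .cut [2, -2, -2, 1, 1, -1, 2, -1, 0]], .grow 6 [.grow 7
    [.cut [2, 2, 1, 1, 1, 1, -3, -3, -4, 4], .grow 0
    [.cut [1, -2, -1, -1, -1, -1, -1, 4, 4, 4, -6],
    .cut [2, -2, -2, -1, -1, -1, -1, 3, 3, 4, -4]]]], .cut [2, 1, 0, 1, -1, -2, -2, 2],
    .cut [2, 0, 1, 0, -2, -2, -2, 2], .cut [2, 1, 0, -1, -1, -2, -2, 2]], .grow 4 [.grow 0
    [.cut [2, -4, -3, 0, 0, 2, 6, 2, -5], .grow 1 [.cut [2, 2, -4, -3, 1, 1, 1, 5, 1, -3],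
    .cut [1, -1, -2, -2, 0, 0, 2, 4, 2, -4], .cut [2, 2, -2, -1, 1, 1, -1, 1, -2, 1],
    .close [0, 0, 0, 0, 0, 0, 0, 0, 0, 0]]], .cut [1, 1, 0, 0, -1, -2, -1, 2]], .grow 5
    [.cut [2, 2, -1, 1, -2, -2, -4, 4], .grow 0 [.grow 6 [.cut [2, -1, 2, 0, 1, 1, -4, -4, -4, 6],
    .cut [2, -2, 2, 0, 1, 1, -2, -2, -2, 3], .grow 0 [.cut [1, -2, 1, -2, 1, -2, 1, 2, 3, 2, -3],
    .cut [4, -7, -1, -2, 1, -4, 4, 3, 7, 4, -7], .cut [1, 1, -1, 2, 0, 2, 1, -4, -4, -4, 6],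
    .cut [2, 0, -2, 2, 0, 1, 1, -2, -2, -2, 2]], .cut [2, -2, 2, -1, 1, -1, -1, -2, -1, 2]],
    .cut [2, -2, 0, 0, -2, 2, 1, 2, -2], .grow 0 [.cut [2, -4, 2, -3, 1, -2, 3, 4, 3, -5],
    .cut [2, -2, 1, -1, 1, -2, 1, 2, 1, -2], .grow 0
    [.cut [1, -2, 0, -2, -1, -1, -1, 4, 4, 4, -6], .cut [2, -2, 0, -1, -1, 0, -2, 2, 2, 2, -2]],
    .close [0, 0, 0, 0, 0, 0, 0, 0, 0, 0]], .grow 6 [.cut [2, 3, -1, 1, 1, -1, -1, -4, -1, 3]]],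
    .grow 0 [.cut [1, -3, -2, 0, 1, 1, 1, 4, -3], .cut [2, -2, -2, 1, 1, 0, 0, 2, -1], .grow 0
    [.cut [1, -3, 3, 0, 0, -2, 2, 2, -1, -1], .cut [2, -2, 1, -2, 1, -1, 1, 2, 1, -2],
    .cut [1, -1, 3, 2, 0, -1, -1, -1, -4, 3], .close [0, 0, 0, 0, 0, 0, 0, 0, 0, 0]],
    .cut [2, -2, -2, 1, 1, -1, -1, 2, 0]], .grow 5 [.grow 6
    [.cut [2, 2, 1, 1, 1, 1, -3, -4, -3, 4], .grow 0
    [.cut [1, -2, -1, -1, -1, -1, -1, 4, 4, 4, -6],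
    .cut [2, -2, -2, -1, -1, -1, -1, 3, 4, 3, -4]]]], .cut [2, 1, 0, 1, -1, -2, -2, 2],
    .cut [2, 0, 1, 0, -2, -2, -2, 2], .cut [2, 1, 0, -1, -1, -2, -2, 2]], .grow 5 [.grow 0
    [.cut [2, -4, -3, 0, 0, 2, 2, 6, -5], .grow 1 [.cut [2, 2, -4, -3, 1, 1, 1, 1, 5, -3],
    .cut [1, -1, -2, -2, 0, 0, 2, 2, 4, -4], .cut [2, 2, -2, -1, 1, 1, -1, -2, 1, 1],
    .close [0, 0, 0, 0, 0, 0, 0, 0, 0, 0]]], .cut [2, 1, 0, 0, -1, -2, -2, 2]],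
    .cut [2, -1, 1, -1, -2, -2, 2]], .cut [1, 1, -2, -1, -1, 2], .cut [2, 0, -2, -2, -1, 2],
    .cut [1, 1, -2, -1, -1, 2], .cut [2, 0, -2, -1, -2, 2], .cut [1, 0, -1, -1, -1, 1]],
    .cut [2, -2, -2, -1, 2], .cut [2, -2, -1, -2, 2], .cut [1, -1, -1, -1, 1]]

/-- A certificate for the complete graph on four vertices minus an edge. -/
def diamondCert : Cert :=
  .grow 0 [.grow 2 [.grow 0 [.grow 1 [.cut [2, 2, -5, -2, 4, 5, -3, -3], .grow 0 [.grow 2 [.grow 5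
    [.cut [5, -3, -3, 6, 6, -15, -11, 17, 19, -12, -12],
    .cut [2, -2, 0, 0, 2, -2, -2, 3, 3, -2, -2], .cut [2, 0, -2, 2, 0, -2, -2, 3, 3, -2, -2],
    .cut [2, -1, -1, 1, 1, -2, -2, 2, 2, -1, -1]], .grow 0
    [.cut [1, -2, 2, -2, 2, 0, 0, 0, 0, 0, 0], .grow 6
    [.cut [5, 3, -3, -3, 6, 6, -15, -11, 17, 19, -12, -12], .grow 0
    [.cut [1, -3, 2, -1, -1, 0, 0, 1, 3, -3, -2, 2, 2],
    .cut [2, 2, -1, 0, 0, 2, 2, -6, -6, 7, 8, -5, -5]]],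
    .cut [1, -2, 1, -1, 2, -1, -1, 1, 1, -1, -1], .cut [2, -1, -1, 1, 1, -3, -2, 3, 3, -2, -2]],
    .grow 0 [.cut [1, -3, 1, -2, 2, 1, 3, -3, -2, 2, 2],
    .cut [3, -5, -1, -1, 3, 0, 4, -4, -2, 2, 2], .grow 0
    [.cut [1, -2, -1, 1, -2, -1, 4, 4, -6, -6, 4, 4], .grow 0
    [.cut [1, -3, 3, -2, 2, -2, 2, 0, -1, 1, 0, 0, 0],
    .cut [1, -1, 2, 1, -1, 2, 1, -4, -4, 6, 6, -4, -4]]],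
    .cut [2, 0, -2, 2, 0, -2, -2, 3, 3, -2, -2]], .cut [2, -2, 2, -2, 0, -2, 1, 1, -1, -1]],
    .cut [2, -2, -2, 5, 2, -4, -5, 3, 3], .grow 0 [.cut [4, -8, 4, -3, 2, 8, -8, -5, 4, 4],
    .cut [2, -2, 2, -2, 0, 2, -1, -1, 1, 1], .grow 0 [.grow 0
    [.cut [1, -3, 4, 0, 2, 2, -6, -6, 8, 8, -5, -5], .grow 0
    [.cut [1, -3, 2, -2, 2, -2, 3, -1, 0, 0, 1, 0, 0],
    .cut [1, -1, -1, 2, 1, 1, 2, -4, -4, 6, 6, -4, -4]]],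
    .cut [2, -2, 0, 0, -2, 2, 2, -3, -3, 2, 2]], .close [0, 0, 0, 0, 0, 0, 0, 0, 0, 0]], .grow 4
    [.cut [2, 3, -1, -1, 1, -4, 3, 1, -1, -1]]], .cut [2, 1, -2, -1, 2, 2, -1, -1],
    .cut [2, 0, -2, -2, 2, 2, -1, -1]], .cut [2, -2, -2, 2, 2, -1, -1]], .grow 0 [.grow 2 [.grow 0
    [.cut [2, -4, 2, -5, 6, -3, 2, 0, 0], .grow 1 [.cut [2, 2, -4, 1, -3, 5, -3, 1, 1, 1],
    .cut [1, -1, -2, 2, -4, 4, -2, 2, 0, 0], .cut [2, 2, -2, -2, 1, 1, -1, -1, 1, 1],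
    .close [0, 0, 0, 0, 0, 0, 0, 0, 0, 0]]], .cut [1, -1, 2, -2, 1, -1, 0, 0]], .grow 0 [.grow 0
    [.grow 1 [.cut [2, 2, -4, 4, -2, -2, 3, 3, -2, -2], .grow 0 [.grow 2 [.grow 0 [.grow 1
    [.cut [2, 2, -4, 0, 1, 4, -5, 6, -4, -4, 5, 5, -3, -3], .grow 0
    [.cut [1, -3, -2, 6, 2, -4, -8, 14, -17, 10, 10, -14, -14, 9, 9],
    .cut [2, -2, -2, 4, 1, -1, -4, 6, -7, 4, 4, -6, -6, 4, 4], .grow 0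
    [.cut [1, -3, 2, 0, -2, 2, -2, 2, 0, 0, 0, 0, 0, 0, 0, 0],
    .cut [2, -2, 2, -2, 0, 2, -1, 1, 0, 0, 0, 0, 0, 0, 0, 0],
    .cut [2, 1, 1, 2, -4, -4, 6, 6, -14, 16, -10, -10, 14, 14, -9, -9],
    .close [0, 0, 0, 0, 0, 0, 1, 1, -1, 1, -1, -1, 1, 1, -1, -1]],
    .cut [3, -2, -2, 3, -2, 2, -3, 0, 0, 0, 0, 0, 0, 0, 0]],
    .cut [2, 2, -3, -2, 1, 3, -4, 4, -2, -2, 3, 3, -2, -2],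
    .cut [2, 0, -2, -2, 2, 2, -4, 5, -3, -3, 4, 4, -3, -3]],
    .cut [2, -2, -2, 2, 2, -4, 4, -2, -2, 3, 3, -2, -2]], .grow 0
    [.cut [1, -2, 2, -2, 2, 0, 0, 0, 0, 0, 0, 0, 0], .grow 0 [.grow 0 [.grow 0
    [.cut [2, -4, 6, -9, 6, 6, -9, -9, 21, -25, 15, 15, -21, -21, 14, 14],
    .cut [2, 2, -6, 9, -6, -6, 9, 9, -21, 25, -15, -15, 21, 21, -14, -14]]]]]],
    .cut [2, -2, -2, 4, -4, 2, 2, -3, -3, 2, 2]]]]]]], .cut [2, -2, -2, 1, 1]]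

attribute [local instance] instDecidableEqBool

lemma check_claw :
    check 14 clawCert [[false, false, true], [false, true], [true], []] = true := by
  decide +kernel

lemma check_diamond :
    check 14 diamondCert [[false, true, true], [true, true], [true], []] = true := by
  decide +kernel

lemma check_complete :
    check 1 (.close [0, 0, 0, 0]) [[true, true, true], [true, true], [true], []] = true := by
  decide +kernel

section Cubic

variable {V : Type} (G : SimpleGraph V)

lemma nbrSum_one_eq_degree [Fintype V] [G.LocallyFinite] (v : V) :
    nbrSum G (fun _ => (1 : ℤ)) v = G.degree v := by
  rw [nbrSum, Finset.sum_boole, SimpleGraph.degree]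
  congr 2
  ext u
  simp

lemma exists_neighbors [G.LocallyFinite] {v : V} (h : G.degree v = 3) :
    ∃ a b c, a ≠ b ∧ a ≠ c ∧ b ≠ c ∧ ∀ u, G.Adj v u ↔ u = a ∨ u = b ∨ u = c := by
  obtain ⟨a, b, c, hab, hac, hbc, hs⟩ := Finset.card_eq_three.1 h
  refine ⟨a, b, c, hab, hac, hbc, fun u => ?_⟩
  rw [← G.mem_neighborFinset, hs]
  simp

/-- The neighbours of `v` are `a`, `b`, `c`, and `ab` is the only edge among them. -/
structure IsTriangleStar (v a b c : V) : Prop where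
  ne_ab : a ≠ b
  ne_ac : a ≠ c
  ne_bc : b ≠ c
  adj_iff : ∀ u, G.Adj v u ↔ u = a ∨ u = b ∨ u = c
  adj_ab : G.Adj a b
  not_adj_ac : ¬ G.Adj a c
  not_adj_bc : ¬ G.Adj b c

variable {G} {v a b c : V}

lemma IsTriangleStar.triangle {d e f w : V} (h : IsTriangleStar G v d e f) (hw : G.Adj v w)
    {u : V} (hu : G.Adj v u) (hwu : G.Adj w u) : w = d ∧ u = e ∨ w = e ∧ u = d := by
  have h1 := h.not_adj_ac
  have h2 := h.not_adj_bc
  have h1' := mt Adj.symm h1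
  have h2' := mt Adj.symm h2
  rcases (h.adj_iff w).1 hw with rfl | rfl | rfl <;>
    rcases (h.adj_iff u).1 hu with rfl | rfl | rfl <;> simp_all

lemma IsTriangleStar.pendant {d e f : V} (h : IsTriangleStar G v a b c)
    (h' : IsTriangleStar G c d e f) : f = v := by
  have hvc : G.Adj v c := (h.adj_iff c).2 (by simp)
  have key : ∀ u, G.Adj c u → ¬ G.Adj v u := by
    intro u hu hvu
    rcases (h.adj_iff u).1 hvu with rfl | rfl | rfl
    · exact h.not_adj_ac hu.symm
    · exact h.not_adj_bc hu.symm
    · exact G.irrefl hu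
  rcases (h'.adj_iff v).1 hvc.symm with rfl | rfl | rfl
  · exact absurd h'.adj_ab (key _ ((h'.adj_iff e).2 (by simp)))
  · exact absurd h'.adj_ab.symm (key _ ((h'.adj_iff d).2 (by simp)))
  · rfl

variable [Fintype V]

lemma IsTriangleStar.nbrSum_eq {x : V → ℝ} (h : IsTriangleStar G v a b c) :
    nbrSum G x v = x a + x b + x c := by
  have hs : (Finset.univ.filter fun u => G.Adj v u) = {a, b, c} := by
    ext u
    simp [h.adj_iff]
  rw [nbrSum, ← Finset.sum_filter, hs, Finset.sum_insert (by simp [h.ne_ab, h.ne_ac]),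
    Finset.sum_pair h.ne_bc, add_assoc]

theorem neg_two_le_lambdaMin [Nonempty V]
    (h : ∀ v, ∃ a b c, IsTriangleStar G v a b c) : -2 ≤ lambdaMin G := by
  choose a b c h using h
  by_contra! hμ
  obtain ⟨x, hx0, hx⟩ := exists_eigenvector_lambdaMin G
  set μ := lambdaMin G
  set s : V → ℝ := fun v => x v + x (a v) + x (b v) with hs
  set t : V → ℝ := fun v => x v + x (c v) with ht
  have hst : ∀ v, (μ + 2) * x v = s v + t v := fun v => by
    have := (h v).nbrSum_eq (x := x)
    rw [hx] at this
    simp only [hs, ht]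
    linarith
  have hsa : ∀ v, s (a v) = s v := fun v => by
    have hva := ((h v).adj_iff (a v)).2 (by simp)
    have hvb := ((h v).adj_iff (b v)).2 (by simp)
    simp only [hs]
    rcases (h (a v)).triangle hva.symm (h v).adj_ab hvb with ⟨h1, h2⟩ | ⟨h1, h2⟩ <;>
      rw [← h1, ← h2] <;> ring
  have hsb : ∀ v, s (b v) = s v := fun v => by
    have hva := ((h v).adj_iff (a v)).2 (by simp)
    have hvb := ((h v).adj_iff (b v)).2 (by simp)
    simp only [hs]
    rcases (h (b v)).triangle hvb.symm (h v).adj_ab.symm hva with ⟨h1, h2⟩ | ⟨h1, h2⟩ <;>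
      rw [← h1, ← h2] <;> ring
  have htc : ∀ v, t (c v) = t v := fun v => by
    simp only [ht, (h v).pendant (h (c v))]
    ring
  have hs_eq : ∀ v, (μ - 1) * s v = t v + t (a v) + t (b v) := fun v => by
    have h1 := hst v
    have h2 := hst (a v)
    have h3 := hst (b v)
    rw [hsa] at h2
    rw [hsb] at h3
    have h4 : s v = x v + x (a v) + x (b v) := rfl
    linear_combination h1 + h2 + h3 + (μ + 2) * h4
  have ht_eq : ∀ v, μ * t v = s v + s (c v) := fun v => by
    have h1 := hst v
    have h2 := hst (c v)
    rw [htc] at h2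
    have h4 : t v = x v + x (c v) := rfl
    linear_combination h1 + h2 + (μ + 2) * h4
  obtain ⟨u, hu⟩ := Finite.exists_max fun v => |s v|
  obtain ⟨w, hw⟩ := Finite.exists_max fun v => |t v|
  have h1 : (1 - μ) * |s u| ≤ 3 * |t w| := by
    have h5 : |(μ - 1) * s u| = (1 - μ) * |s u| := by
      rw [abs_mul, abs_of_neg (by linarith : μ - 1 < 0), neg_sub]
    rw [← h5, hs_eq]
    linarith [abs_add_three (t u) (t (a u)) (t (b u)), hw u, hw (a u), hw (b u)]
  have h2 : -μ * |t w| ≤ 2 * |s u| := by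
    have h5 : |μ * t w| = -μ * |t w| := by rw [abs_mul, abs_of_neg (by linarith : μ < 0)]
    rw [← h5, ht_eq]
    linarith [abs_add_le (s w) (s (c w)), hu w, hu (c w)]
  have h3 : |s u| = 0 := by
    by_contra h0
    have hp : 0 < |s u| := lt_of_le_of_ne (abs_nonneg _) (Ne.symm h0)
    nlinarith [abs_nonneg (t w)]
  have h4 : |t w| = 0 := by
    rw [h3] at h2
    nlinarith [abs_nonneg (t w)]
  refine hx0 (funext fun v => ?_)
  have hsv : s v = 0 := abs_eq_zero.1 (le_antisymm ((hu v).trans_eq h3) (abs_nonneg _))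
  have htv : t v = 0 := abs_eq_zero.1 (le_antisymm ((hw v).trans_eq h4) (abs_nonneg _))
  have := hst v
  rw [hsv, htv, add_zero] at this
  exact (mul_eq_zero.1 this).resolve_left (by linarith)

theorem gap_lambdaMin [G.LocallyFinite] (hc : G.Connected) (hG : G.IsRegularOfDegree 3)
    (hμ : lambdaMin G < -2) : Gap (lambdaMin G) := by
  have hG' : ∀ v, nbrSum G (fun _ => (1 : ℤ)) v = 3 := fun v => by
    rw [nbrSum_one_eq_degree, hG v]
    rfl
  by_contra hgap
  have start : ∀ {v a b c : V}, a ≠ b → a ≠ c → b ≠ c →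
      (∀ u, G.Adj v u ↔ u = a ∨ u = b ∨ u = c) → ∀ (k : ℕ) (t : Cert),
      check k t [[decide (G.Adj c b), decide (G.Adj c a), true], [decide (G.Adj b a), true],
        [true], []] ≠ true := by
    intro v a b c hab hac hbc hv k t hcheck
    have ha : G.Adj v a := (hv a).2 (by simp)
    have hb : G.Adj v b := (hv b).2 (by simp)
    have hc' : G.Adj v c := (hv c).2 (by simp)
    refine hgap (gap_of_check G hG' hc hμ k t [c, b, a, v] ?_ (by simp) ?_)
    · simp [hab.symm, hac.symm, hbc.symm, ha.ne', hb.ne', hc'.ne']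
    · simpa [code, ha.symm, hb.symm, hc'.symm] using hcheck
  have := hc.nonempty
  refine hμ.not_ge (neg_two_le_lambdaMin fun v => ?_)
  obtain ⟨a, b, c, hab, hac, hbc, hv⟩ := exists_neighbors G (hG v)
  have hv₁ : ∀ u, G.Adj v u ↔ u = a ∨ u = c ∨ u = b := fun u => by rw [hv]; tauto
  have hv₂ : ∀ u, G.Adj v u ↔ u = b ∨ u = a ∨ u = c := fun u => by rw [hv]; tauto
  have hv₃ : ∀ u, G.Adj v u ↔ u = b ∨ u = c ∨ u = a := fun u => by rw [hv]; tauto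
  have hv₄ : ∀ u, G.Adj v u ↔ u = c ∨ u = b ∨ u = a := fun u => by rw [hv]; tauto
  by_cases h1 : G.Adj b a <;> by_cases h2 : G.Adj c a <;> by_cases h3 : G.Adj c b
  · exact absurd (by simpa [h1, h2, h3] using check_complete) (start hab hac hbc hv _ _)
  · exact absurd (by simpa [h1, h2, h3] using check_diamond) (start hab hac hbc hv _ _)
  · exact absurd (by simpa [h1.symm, h2, h3] using check_diamond)
      (start hab.symm hbc hac hv₂ _ _)
  · exact ⟨a, b, c, hab, hac, hbc, hv, h1.symm, mt Adj.symm h2, mt Adj.symm h3⟩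
  · exact absurd (by simpa [h1, mt Adj.symm h1, h2.symm, h3.symm] using check_diamond)
      (start hbc.symm hac.symm hab.symm hv₄ _ _)
  · exact ⟨a, c, b, hac, hab, hbc.symm, hv₁, h2.symm, mt Adj.symm h1, h3⟩
  · exact ⟨b, c, a, hbc, hab.symm, hac.symm, hv₃, h3.symm, h1, h2⟩
  · exact absurd (by simpa [h1, h2, h3] using check_claw) (start hab hac hbc hv _ _)

end Cubic

section Extremal

/-- The edges of an extremal graph on 16 vertices. -/
def extremalEdges : List (ℕ × ℕ) :=
  [(1, 0), (2, 0), (2, 1), (3, 0), (3, 1), (4, 3), (5, 2), (5, 4), (6, 4), (6, 5), (7, 6), (8, 7),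
    (9, 7), (9, 8), (10, 9), (11, 8), (12, 11), (13, 11), (13, 12), (14, 10), (14, 13), (15, 10),
    (15, 12), (15, 14)]

/-- The adjacency test of the extremal graph. -/
def extremalAdj (i j : Fin 16) : Bool :=
  extremalEdges.any fun e =>
    Nat.beq e.1 i && Nat.beq e.2 j || Nat.beq e.1 j && Nat.beq e.2 i

/-- A connected cubic graph whose least eigenvalue is the least root of the sextic polynomial. -/
def extremalGraph : SimpleGraph (Fin 16) where
  Adj i j := extremalAdj i j = true
  symm := ⟨fun i j h => by simpa only [extremalAdj, Bool.or_comm] using h⟩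
  loopless := ⟨fun i => by
    have h : ((List.finRange 16).all fun i => !extremalAdj i i) = true := by decide +kernel
    simpa using List.all_eq_true.1 h i (List.mem_finRange i)⟩

/-- The encoding of an adjacency test. -/
def codeOf {V : Type} (f : V → V → Bool) : List V → List (List Bool)
  | [] => []
  | w :: xs => xs.map (f w) :: codeOf f xs

lemma code_extremalGraph (xs : List (Fin 16)) :
    code extremalGraph xs = codeOf extremalAdj xs := by
  induction xs with
  | nil => rfl
  | cons w xs ih =>
    rw [code, codeOf, ih]
    congr 1
    exact List.map_congr_left fun u _ => Bool.eq_iff_iff.2 decide_eq_true_iff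

lemma closes_extremalGraph : closes (code extremalGraph (List.finRange 16))
    [-1, -1, 1, 1, -1, -1, 1, -1, 1, 1, 0, 0, 0, 0, 0, 0] = true := by
  rw [code_extremalGraph]
  decide +kernel

lemma lambdaMin_extremalGraph_lt : lambdaMin extremalGraph < -2 := by
  have h : cuts 2 1 (code extremalGraph (List.finRange 16))
      [-10, -10, 15, 15, -11, -11, 18, -15, 6, 6, -4, -4, 1, 1, 1, 1] = true := by
    rw [code_extremalGraph]
    decide +kernel
  simpa using lambdaMin_lt_of_cuts extremalGraph (List.nodup_finRange 16) one_pos h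

lemma connected_extremalGraph : extremalGraph.Connected := by
  have hb : ((List.finRange 16).all fun i => Nat.beq i 0 ||
      (List.finRange 16).any fun j => Nat.blt j i && extremalAdj i j) = true := by decide +kernel
  have h : ∀ i : Fin 16, i = 0 ∨ ∃ j < i, extremalGraph.Adj i j := fun i => by
    have hi := List.all_eq_true.1 hb i (List.mem_finRange i)
    rw [Bool.or_eq_true, List.any_eq_true] at hi
    refine hi.imp (fun h0 => Fin.ext (Nat.eq_of_beq_eq_true h0)) fun ⟨j, _, hj⟩ => ?_
    rw [Bool.and_eq_true, Nat.blt_eq] at hj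
    exact ⟨j, hj⟩
  have hr : ∀ i, extremalGraph.Reachable i 0 := fun i => by
    induction i using WellFoundedLT.induction with
    | ind i ih =>
      rcases h i with rfl | ⟨j, hj, hij⟩
      · exact .rfl
      · exact hij.reachable.trans (ih j hj)
  exact connected_iff_exists_forall_reachable _ |>.2 ⟨0, fun i => (hr i).symm⟩

lemma nbrSum_extremalGraph (v : Fin 16) : nbrSum extremalGraph (fun _ => (1 : ℤ)) v = 3 := by
  have h := closes_extremalGraph
  simp only [closes, Bool.and_eq_true] at h
  rw [← listSum_eq_three_of_degrees _ h.1.1.2 v (List.mem_finRange v),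
    listSum_eq_nbrSum _ (List.nodup_finRange 16) (by simp)]

lemma isRegularOfDegree_extremalGraph [extremalGraph.LocallyFinite] :
    extremalGraph.IsRegularOfDegree 3 := fun v => by
  exact_mod_cast (nbrSum_one_eq_degree extremalGraph v).symm.trans (nbrSum_extremalGraph v)

lemma sextic_lambdaMin_extremalGraph :
    lambdaMin extremalGraph ^ 6 - 3 * lambdaMin extremalGraph ^ 5 -
      7 * lambdaMin extremalGraph ^ 4 + 21 * lambdaMin extremalGraph ^ 3 +
      13 * lambdaMin extremalGraph ^ 2 - 35 * lambdaMin extremalGraph - 4 = 0 :=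
  sextic_lambdaMin_of_closes extremalGraph nbrSum_extremalGraph connected_extremalGraph
    lambdaMin_extremalGraph_lt (List.nodup_finRange 16) (by simp) closes_extremalGraph

end Extremal

lemma sextic_strictAnti {x y : ℝ} (hxy : x < y) (hy : y ≤ -2) :
    y ^ 6 - 3 * y ^ 5 - 7 * y ^ 4 + 21 * y ^ 3 + 13 * y ^ 2 - 35 * y - 4 <
      x ^ 6 - 3 * x ^ 5 - 7 * x ^ 4 + 21 * x ^ 3 + 13 * x ^ 2 - 35 * x - 4 := by
  obtain ⟨s, rfl⟩ : ∃ s, x = -2 - s := ⟨-2 - x, by ring⟩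
  obtain ⟨t, rfl⟩ : ∃ t, y = -2 - t := ⟨-2 - y, by ring⟩
  have ht : 0 ≤ t := by linarith
  have hts : t < s := by linarith
  have h (n : ℕ) (hn : n ≠ 0) : t ^ n < s ^ n := pow_lt_pow_left₀ hts ht hn
  linarith [h 2 (by simp), h 3 (by simp), h 4 (by simp), h 5 (by simp), h 6 (by simp)]

end CubicSearch

open CubicSearch

/-- Let `β` be the smallest real root of `x⁶-3x⁵-7x⁴+21x³+13x²-35x-4`. Every connected
3-regular graph with `λmin < -2` satisfies `λmin ≤ β`; moreover some connected 3-regular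
graph attains `λmin = β`. Hence `β` is the greatest element (attained supremum) of the set of
values `λmin(G)` over connected 3-regular graphs `G` with `λmin(G) < -2`. -/
theorem stmt_7 (β : ℝ)
    (hβ : IsLeast {x : ℝ | x ^ 6 - 3 * x ^ 5 - 7 * x ^ 4 + 21 * x ^ 3 + 13 * x ^ 2
      - 35 * x - 4 = 0} β) :
    (∀ (n : ℕ) (G : SimpleGraph (Fin n)), G.Connected → G.IsRegularOfDegree 3 →
      lambdaMin G < -2 → lambdaMin G ≤ β) ∧
    (∃ (n : ℕ) (G : SimpleGraph (Fin n)), G.Connected ∧ G.IsRegularOfDegree 3 ∧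
      lambdaMin G = β) ∧
    IsGreatest {x : ℝ | ∃ (n : ℕ) (G : SimpleGraph (Fin n)), G.Connected ∧
      G.IsRegularOfDegree 3 ∧ lambdaMin G < -2 ∧ lambdaMin G = x} β := by
  have hroot := sextic_lambdaMin_extremalGraph
  have hlt := lambdaMin_extremalGraph_lt
  have hβlt : β < -2 := (hβ.2 hroot).trans_lt hlt
  have heq : ∀ x : ℝ, x < -2 → x ^ 6 - 3 * x ^ 5 - 7 * x ^ 4 + 21 * x ^ 3 + 13 * x ^ 2
      - 35 * x - 4 = 0 → x = β := fun x hx h => by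
    refine ((hβ.2 h).eq_or_lt.resolve_right fun h' => ?_).symm
    have h1 := sextic_strictAnti h' hx.le
    rw [h, hβ.1] at h1
    exact lt_irrefl _ h1
  have hle : ∀ (n : ℕ) (G : SimpleGraph (Fin n)), G.Connected → G.IsRegularOfDegree 3 →
      lambdaMin G < -2 → lambdaMin G ≤ β := fun n G hc hG hμ => by
    rcases gap_lambdaMin hc hG hμ with h | h
    · by_contra! hlt'
      have h1 := sextic_strictAnti (x := β) (y := -104 / 51) (by linarith) (by norm_num)
      rw [hβ.1] at h1
      norm_num at h1
    · exact (heq _ hμ h).le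
  have hext := heq _ hlt hroot
  refine ⟨hle, ⟨16, extremalGraph, connected_extremalGraph, isRegularOfDegree_extremalGraph, hext⟩,
    ⟨16, extremalGraph, connected_extremalGraph, isRegularOfDegree_extremalGraph, hlt, hext⟩, ?_⟩
  rintro x ⟨n, G, hc, hG, hμ, rfl⟩
  exact hle n G hc hG hμ
end
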